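/- arXiv:2003.01983 — 6 statements merged into one kernel-verified Lean document; each statement's English description precedes it below -/
import Mathlib

section
/- Let B be a left brace. Define r_B : B × B → B × B by r_B(a,b) = (λ_a(b), λ^{-1}_{λ_a(b)}(a)). Then (B, r_B) is an involutive non-degenerate set-theoretic solution of the Yang–Baxter equation. -/
/-- The map `σ_x : y ↦` first component of `r(x,y)`. -/
def sigmaMap {X : Type*} (r : X × X → X × X) (x : X) : X → X := fun y => (r (x, y)).1

/-- The map `γ_y : x ↦` second component of `r(x,y)`. -/
def gammaMap {X : Type*} (r : X × X → X × X) (y : X) : X → X := fun x => (r (x, y)).2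

/-- `r₁₂ = r × id` on `X³`. -/
def rMap12 {X : Type*} (r : X × X → X × X) : X × X × X → X × X × X :=
  fun p => ((r (p.1, p.2.1)).1, (r (p.1, p.2.1)).2, p.2.2)

/-- `r₂₃ = id × r` on `X³`. -/
def rMap23 {X : Type*} (r : X × X → X × X) : X × X × X → X × X × X :=
  fun p => (p.1, r p.2)

/-- `(X, r)` is an involutive non-degenerate set-theoretic solution of the
Yang–Baxter equation: `r² = id`, all `σ_x` and `γ_y` are bijective, and
`r₁₂ r₂₃ r₁₂ = r₂₃ r₁₂ r₂₃`. -/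
def IsYBSolution {X : Type*} (r : X × X → X × X) : Prop :=
  (∀ p, r (r p) = p) ∧
  (∀ x, Function.Bijective (sigmaMap r x)) ∧
  (∀ y, Function.Bijective (gammaMap r y)) ∧
  rMap12 r ∘ rMap23 r ∘ rMap12 r = rMap23 r ∘ rMap12 r ∘ rMap23 r

/-- The lambda map of a left brace: `λ_a(b) = a·b − a`. -/
def lambdaMap {B : Type*} [AddCommGroup B] [Group B] (a : B) : B → B := fun b => a * b - a

/-- The left brace axiom: `(B,+)` abelian group, `(B,·)` group, and
`a·(b+c) + a = a·b + a·c`. -/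
def IsLeftBrace (B : Type*) [AddCommGroup B] [Group B] : Prop :=
  ∀ a b c : B, a * (b + c) + a = a * b + a * c

/-- The solution associated to a left brace `B`:
`r_B(a,b) = (λ_a(b), λ⁻¹_{λ_a(b)}(a))`. -/
noncomputable def braceSolution {B : Type*} [AddCommGroup B] [Group B] : B × B → B × B :=
  fun p => (lambdaMap p.1 p.2, Function.invFun (lambdaMap (lambdaMap p.1 p.2)) p.1)

namespace IsLeftBrace

variable {B : Type*} [AddCommGroup B] [Group B]

theorem zero_eq_one (h : IsLeftBrace B) : (0 : B) = 1 := by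
  have h0 := h 1 0 0
  simpa using h0.symm

theorem mul_sub_eq (h : IsLeftBrace B) (a b c : B) : a * (b - c) = a * b - a * c + a := by
  have h0 := h a (b - c) c
  rw [sub_add_cancel] at h0
  rw [sub_add_eq_add_sub, h0, add_sub_cancel_right]

theorem lambdaMap_mul (h : IsLeftBrace B) (a b c : B) :
    lambdaMap (a * b) c = lambdaMap a (lambdaMap b c) := by
  simp only [lambdaMap, h.mul_sub_eq, mul_assoc, add_sub_cancel_right]

theorem lambdaMap_one (h : IsLeftBrace B) (a : B) : lambdaMap 1 a = a := by
  simp [lambdaMap, ← h.zero_eq_one, show (0 : B) * a = a by rw [h.zero_eq_one, one_mul]]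

theorem lambdaMap_inv_lambdaMap (h : IsLeftBrace B) (a b : B) :
    lambdaMap a⁻¹ (lambdaMap a b) = b := by
  rw [← h.lambdaMap_mul, inv_mul_cancel, h.lambdaMap_one]

theorem lambdaMap_lambdaMap_inv (h : IsLeftBrace B) (a b : B) :
    lambdaMap a (lambdaMap a⁻¹ b) = b := by
  rw [← h.lambdaMap_mul, mul_inv_cancel, h.lambdaMap_one]

theorem lambdaMap_bijective (h : IsLeftBrace B) (a : B) :
    Function.Bijective (lambdaMap a) :=
  Function.bijective_iff_has_inverse.mpr
    ⟨lambdaMap a⁻¹, h.lambdaMap_inv_lambdaMap a, h.lambdaMap_lambdaMap_inv a⟩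

theorem braceSolution_snd (h : IsLeftBrace B) (a b : B) :
    (braceSolution (a, b)).2 = lambdaMap (lambdaMap a b)⁻¹ a := by
  apply (h.lambdaMap_bijective (lambdaMap a b)).injective
  rw [h.lambdaMap_lambdaMap_inv]
  exact Function.invFun_eq ((h.lambdaMap_bijective _).surjective a)

/-- The two components of `r_B(a,b)` have product `a·b`. -/
theorem braceSolution_fst_mul_snd (h : IsLeftBrace B) (a b : B) :
    (braceSolution (a, b)).1 * (braceSolution (a, b)).2 = a * b := by
  have h1 := h.lambdaMap_lambdaMap_inv (lambdaMap a b) a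
  rw [← h.braceSolution_snd] at h1
  change lambdaMap a b * (braceSolution (a, b)).2 = a * b
  generalize (braceSolution (a, b)).2 = v at h1 ⊢
  rw [lambdaMap, sub_eq_iff_eq_add] at h1
  rw [h1, lambdaMap, add_sub_cancel]

/-- The second component of `r_B(a,b)` is conjugate to `λ` under inversion. -/
theorem braceSolution_eq (h : IsLeftBrace B) (a b : B) :
    braceSolution (a, b) = (lambdaMap a b, (lambdaMap b⁻¹ a⁻¹)⁻¹) := by
  refine Prod.ext rfl ?_
  have h1 := h.braceSolution_fst_mul_snd a b
  rw [← eq_inv_mul_iff_mul_eq] at h1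
  rw [h1, eq_comm, inv_eq_iff_eq_inv]
  change _ = ((lambdaMap a b)⁻¹ * (a * b))⁻¹
  rw [mul_inv_rev, inv_inv, lambdaMap, lambdaMap, h.mul_sub_eq, inv_mul_cancel, mul_inv_rev,
    inv_mul_cancel_right, ← h.zero_eq_one]
  abel

theorem lambdaMap_mul_inv_lambdaMap (h : IsLeftBrace B) (a b : B) :
    lambdaMap a b * (lambdaMap b⁻¹ a⁻¹)⁻¹ = a * b := by
  simpa [h.braceSolution_eq] using h.braceSolution_fst_mul_snd a b

theorem braceSolution_involutive (h : IsLeftBrace B) (p : B × B) :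
    braceSolution (braceSolution p) = p := by
  obtain ⟨a, b⟩ := p
  have h1 : (braceSolution (braceSolution (a, b))).1 = a := by
    change lambdaMap (lambdaMap a b) (braceSolution (a, b)).2 = a
    rw [h.braceSolution_snd, h.lambdaMap_lambdaMap_inv]
  refine Prod.ext h1 ?_
  have h2 := h.braceSolution_fst_mul_snd (braceSolution (a, b)).1 (braceSolution (a, b)).2
  rw [Prod.mk.eta, h1, h.braceSolution_fst_mul_snd] at h2
  exact mul_left_cancel h2

theorem gammaMap_bijective (h : IsLeftBrace B) (b : B) :
    Function.Bijective (gammaMap braceSolution b) := by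
  have h1 : gammaMap braceSolution b = Inv.inv ∘ lambdaMap b⁻¹ ∘ Inv.inv := by
    funext a
    simp [gammaMap, h.braceSolution_eq]
  rw [h1]
  exact inv_involutive.bijective.comp ((h.lambdaMap_bijective _).comp inv_involutive.bijective)

theorem braceSolution_braid (h : IsLeftBrace B) :
    rMap12 braceSolution ∘ rMap23 braceSolution ∘ rMap12 (braceSolution (B := B)) =
      rMap23 braceSolution ∘ rMap12 braceSolution ∘ rMap23 braceSolution := by
  have prod12 (p : B × B × B) :
      (rMap12 braceSolution p).1 * (rMap12 braceSolution p).2.1 * (rMap12 braceSolution p).2.2 =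
        p.1 * p.2.1 * p.2.2 := by
    simp [rMap12, h.braceSolution_fst_mul_snd]
  have prod23 (p : B × B × B) :
      (rMap23 braceSolution p).1 * (rMap23 braceSolution p).2.1 * (rMap23 braceSolution p).2.2 =
        p.1 * p.2.1 * p.2.2 := by
    simp [rMap23, mul_assoc, h.braceSolution_fst_mul_snd]
  have eq_of_prod_eq {p q : B × B × B} (h1 : p.1 = q.1) (h3 : p.2.2 = q.2.2)
      (hm : p.1 * p.2.1 * p.2.2 = q.1 * q.2.1 * q.2.2) : p = q := by
    rw [h1, h3] at hm
    exact Prod.ext h1 (Prod.ext (mul_left_cancel (mul_right_cancel hm)) h3)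
  funext p
  obtain ⟨a, b, c⟩ := p
  apply eq_of_prod_eq
  · simp only [Function.comp, rMap12, rMap23, h.braceSolution_eq]
    rw [← h.lambdaMap_mul, ← h.lambdaMap_mul, h.lambdaMap_mul_inv_lambdaMap]
  · simp only [Function.comp, rMap12, rMap23, h.braceSolution_eq, inv_inv]
    have h1 := congrArg Inv.inv (h.lambdaMap_mul_inv_lambdaMap b c)
    rw [mul_inv_rev, mul_inv_rev, inv_inv] at h1
    rw [← h.lambdaMap_mul, ← h.lambdaMap_mul, h1]
  · simp only [Function.comp, prod12, prod23]

end IsLeftBrace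

/-- for a left brace `B`, `(B, r_B)` is an involutive non-degenerate
set-theoretic solution of the Yang–Baxter equation. -/
theorem braceSolution_isYBSolution {B : Type*} [AddCommGroup B] [Group B]
    (hbrace : IsLeftBrace B) :
    IsYBSolution (braceSolution (B := B)) := by
  exact ⟨hbrace.braceSolution_involutive, hbrace.lambdaMap_bijective,
    hbrace.gammaMap_bijective, hbrace.braceSolution_braid⟩
end

section
/- Let B be a finite left brace and p a prime. Then the Sylow p-subgroup B_p of the additive group (B,+) is a left ideal of B; that is, λ_a(b) ∈ B_p for all a ∈ B and b ∈ B_p. -/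
/-- In a left brace, each `λ_a` is an endomorphism of the additive group. -/
theorem IsLeftBrace.lambdaMap_add {B : Type*} [AddCommGroup B] [Group B]
    (hbrace : IsLeftBrace B) (a b c : B) :
    lambdaMap a (b + c) = lambdaMap a b + lambdaMap a c := by
  have h : a * (b + c) = a * b + a * c - a := eq_sub_of_add_eq (hbrace a b c)
  simp only [lambdaMap, h]
  abel

/-- A Sylow subgroup of a commutative group is preserved by every endomorphism. -/
theorem Sylow.map_le_self {G : Type*} [CommGroup G] {p : ℕ} (P : Sylow p G) (f : G →* G) :
    (P : Subgroup G).map f ≤ P := by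
  have hsup : IsPGroup p ((P : Subgroup G) ⊔ (P : Subgroup G).map f : Subgroup G) :=
    P.isPGroup'.to_sup_of_normal_left (P.isPGroup'.map f)
  exact le_sup_right.trans (P.is_maximal' hsup le_sup_left).le

/-- for a finite left brace `B` and a prime `p`, any Sylow `p`-subgroup
of the additive group `(B,+)` (viewed as `Multiplicative B`) is a left ideal of `B`:
it is closed under all the maps `λ_a`. -/
theorem sylow_add_subgroup_is_left_ideal {B : Type*} [Fintype B] [AddCommGroup B] [Group B]
    (hbrace : IsLeftBrace B) (p : ℕ) (hp : p.Prime)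
    (P : Sylow p (Multiplicative B)) (a b : B)
    (hb : Multiplicative.ofAdd b ∈ (P : Subgroup (Multiplicative B))) :
    Multiplicative.ofAdd (lambdaMap a b) ∈ (P : Subgroup (Multiplicative B)) :=
  P.map_le_self (AddMonoidHom.mk' (lambdaMap a) (hbrace.lambdaMap_add a)).toMultiplicative
    (Subgroup.mem_map_of_mem _ hb)
end

section
/- Let B be a finite left brace with prime factors p_1, …, p_k of |B|, and let B_1, …, B_k be the Sylow p_i-subgroups of the additive group (B,+). Then B = B_1 + ⋯ + B_k = B_1 ⋯ B_k (product in the multiplicative group), and B_i·B_j = B_i + B_j = B_j + B_i = B_j·B_i for all i, j; in particular {B_1, …, B_k} is a Sylow system of the solvable group (B,·). -/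
open scoped Pointwise

/-- The subset of `B` corresponding to a Sylow subgroup of the additive group
`(B,+)`, i.e. of `Multiplicative B`. -/
def sylowSet {B : Type*} [AddCommGroup B] (p : ℕ) (P : Sylow p (Multiplicative B)) : Set B :=
  {b : B | Multiplicative.ofAdd b ∈ (P : Subgroup (Multiplicative B))}

namespace IsLeftBrace

variable {B : Type*} [AddCommGroup B] [Group B]

theorem one_eq_zero (hB : IsLeftBrace B) : (1 : B) = 0 := by
  simpa using hB 1 0 0

theorem lambdaMap_add_s10 (hB : IsLeftBrace B) (a b c : B) :
    lambdaMap a (b + c) = lambdaMap a b + lambdaMap a c := by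
  unfold lambdaMap
  rw [eq_sub_of_add_eq (hB a b c)]
  abel

/-- The lambda map `λ_a` as an endomorphism of the additive group. -/
def lambdaHom (hB : IsLeftBrace B) (a : B) : B →+ B :=
  AddMonoidHom.mk' (lambdaMap a) (hB.lambdaMap_add_s10 a)

theorem mul_eq_add_lambdaMap (a b : B) : a * b = a + lambdaMap a b := by
  simp [lambdaMap]

theorem mul_lambdaMap_inv (hB : IsLeftBrace B) (a c : B) :
    a * lambdaMap a⁻¹ c = a + c := by
  have h := hB a (a⁻¹ * c - a⁻¹) a⁻¹
  simp only [sub_add_cancel, mul_inv_cancel_left, mul_inv_cancel, hB.one_eq_zero, add_zero] at h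
  rw [lambdaMap, ← h, add_comm]

theorem inv_eq_neg_lambdaMap (hB : IsLeftBrace B) (a : B) : a⁻¹ = -lambdaMap a⁻¹ a := by
  rw [eq_neg_iff_add_eq_zero, ← mul_eq_add_lambdaMap, inv_mul_cancel, hB.one_eq_zero]

/-- The elementwise product of two sets agrees with their sum if the second one is
invariant under the lambda maps. -/
theorem mul_eq_add_of_invariant (hB : IsLeftBrace B) (S : Set B) {T : Set B}
    (hT : ∀ a, ∀ b ∈ T, lambdaMap a b ∈ T) : S * T = S + T := by
  ext x
  simp only [Set.mem_mul, Set.mem_add]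
  constructor
  · rintro ⟨a, ha, b, hb, rfl⟩
    exact ⟨a, ha, _, hT a b hb, (mul_eq_add_lambdaMap a b).symm⟩
  · rintro ⟨a, ha, b, hb, rfl⟩
    exact ⟨a, ha, _, hT a⁻¹ b hb, hB.mul_lambdaMap_inv a b⟩

/-- A finite sum of elements of invariant sets is also an ordered product of such elements. -/
theorem exists_sum_eq_prod (hB : IsLeftBrace B) {k : ℕ} (S : Fin k → Set B)
    (hS : ∀ i a, ∀ b ∈ S i, lambdaMap a b ∈ S i) (f : Fin k → B) (hf : ∀ i, f i ∈ S i) :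
    ∃ g : Fin k → B, (∀ i, g i ∈ S i) ∧ ∑ i, f i = (List.ofFn g).prod := by
  induction k with
  | zero => exact ⟨f, hf, by simp [hB.one_eq_zero]⟩
  | succ n ih =>
    obtain ⟨g, hg, hfg⟩ := ih (fun i => S i.succ) (fun i => hS i.succ)
      (fun i => lambdaMap (f 0)⁻¹ (f i.succ)) (fun i => hS _ _ _ (hf _))
    refine ⟨Fin.cons (f 0) g, Fin.cases (hf 0) hg, ?_⟩
    have h : ∑ i : Fin n, lambdaMap (f 0)⁻¹ (f i.succ)
        = lambdaMap (f 0)⁻¹ (∑ i : Fin n, f i.succ) :=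
      (map_sum (hB.lambdaHom (f 0)⁻¹) _ _).symm
    rw [Fin.sum_univ_succ, ← hB.mul_lambdaMap_inv, ← h, hfg]
    simp [List.ofFn_succ]

/-- An additive subgroup which is invariant under the lambda maps is a subgroup of the
multiplicative group. -/
def invariantSubgroup (hB : IsLeftBrace B) (H : AddSubgroup B)
    (hH : ∀ a, ∀ b ∈ H, lambdaMap a b ∈ H) : Subgroup B where
  carrier := H
  one_mem' := by
    rw [hB.one_eq_zero]
    exact H.zero_mem
  mul_mem' {a b} ha hb := by
    rw [mul_eq_add_lambdaMap]
    exact H.add_mem ha (hH a b hb)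
  inv_mem' {a} ha := by
    change a⁻¹ ∈ H
    rw [hB.inv_eq_neg_lambdaMap]
    exact H.neg_mem (hH _ a ha)

/-- The Sylow subgroups of the additive group are invariant under the lambda maps. -/
theorem lambdaMap_mem_sylowSet (hB : IsLeftBrace B) {p : ℕ} (P : Sylow p (Multiplicative B))
    (a : B) {b : B} (hb : b ∈ sylowSet p P) : lambdaMap a b ∈ sylowSet p P := by
  have hsup := (P.2.map (hB.lambdaHom a).toMultiplicative).to_sup_of_normal_right P.2
  have hle := P.is_maximal' hsup le_sup_right
  have hmem := Subgroup.mem_map_of_mem (hB.lambdaHom a).toMultiplicative hb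
  exact hle.le (Subgroup.mem_sup_left hmem)

end IsLeftBrace

/-- A finite commutative group is generated by any family of Sylow subgroups which
covers all prime divisors of its order. -/
theorem iSup_sylow_eq_top {G ι : Type*} [Group G] [Finite G] (p : ι → ℕ)
    (hp : ∀ i, (p i).Prime) (hfac : ∀ q : ℕ, q.Prime → q ∣ Nat.card G → ∃ i, p i = q)
    (P : ∀ i, Sylow (p i) G) : ⨆ i, (P i : Subgroup G) = ⊤ := by
  apply Subgroup.eq_top_of_le_card
  apply Nat.le_of_dvd Nat.card_pos
  rw [← Nat.factorization_prime_le_iff_dvd Nat.card_pos.ne' Nat.card_pos.ne']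
  intro q hq
  by_cases hqG : q ∣ Nat.card G
  · obtain ⟨i, rfl⟩ := hfac q hq hqG
    have := Fact.mk (hp i)
    rw [← hq.pow_dvd_iff_le_factorization Nat.card_pos.ne', ← (P i).card_eq_multiplicity]
    exact Subgroup.card_dvd_of_le (le_iSup (fun i => (P i : Subgroup G)) i)
  · simp [Nat.factorization_eq_zero_of_not_dvd hqG]

theorem exists_sum_mem_sylowSet {B : Type*} [Finite B] [AddCommGroup B] {ι : Type*} [Fintype ι]
    (p : ι → ℕ) (hp : ∀ i, (p i).Prime)
    (hfac : ∀ q : ℕ, q.Prime → q ∣ Nat.card B → ∃ i, p i = q)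
    (P : ∀ i, Sylow (p i) (Multiplicative B)) (b : B) :
    ∃ f : ι → B, (∀ i, f i ∈ sylowSet (p i) (P i)) ∧ b = ∑ i, f i := by
  classical
  have hb : Multiplicative.ofAdd b ∈ ⨆ i, (P i : Subgroup (Multiplicative B)) := by
    rw [iSup_sylow_eq_top (G := Multiplicative B) p hp hfac P]
    trivial
  refine Subgroup.iSup_induction (fun i => (P i : Subgroup (Multiplicative B)))
    (C := fun x => ∃ f : ι → B, (∀ i, f i ∈ sylowSet (p i) (P i)) ∧ x.toAdd = ∑ i, f i)
    hb ?_ ?_ ?_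
  · intro i x hx
    refine ⟨Pi.single i x.toAdd, fun j => ?_, by simp⟩
    obtain rfl | hij := eq_or_ne j i
    · simpa [sylowSet] using hx
    · simp [sylowSet, hij]
  · exact ⟨0, fun i => (P i).one_mem, by simp⟩
  · rintro x y ⟨f, hf, hx⟩ ⟨g, hg, hy⟩
    exact ⟨f + g, fun i => (P i).mul_mem (hf i) (hg i), by simp [hx, hy, Finset.sum_add_distrib]⟩

/-- let `B` be a finite left brace, `p_1, …, p_k` the prime factors of
`|B|` and `B_i` the Sylow `p_i`-subgroup of `(B,+)`.  Then
`B = B_1 + ⋯ + B_k = B_1 ⋯ B_k`, and `B_i·B_j = B_i + B_j = B_j + B_i = B_j·B_i`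
for all `i, j`; in particular each `B_i` is also a Sylow `p_i`-subgroup of the
multiplicative group `(B,·)`, so that `{B_1, …, B_k}` is a Sylow system of the
solvable group `(B,·)`. -/
theorem sylow_system_of_finite_brace {B : Type*} [Fintype B] [AddCommGroup B] [Group B]
    (hbrace : IsLeftBrace B) (k : ℕ) (p : Fin k → ℕ)
    (hp : ∀ i, (p i).Prime) (hinj : Function.Injective p)
    (hfac : ∀ q : ℕ, q.Prime → (q ∣ Fintype.card B ↔ ∃ i, p i = q))
    (P : ∀ i, Sylow (p i) (Multiplicative B)) :
    (∀ b : B, ∃ f : Fin k → B, (∀ i, f i ∈ sylowSet (p i) (P i)) ∧ b = ∑ i, f i) ∧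
    (∀ b : B, ∃ f : Fin k → B, (∀ i, f i ∈ sylowSet (p i) (P i)) ∧ b = (List.ofFn f).prod) ∧
    (∀ i j,
      sylowSet (p i) (P i) * sylowSet (p j) (P j) = sylowSet (p i) (P i) + sylowSet (p j) (P j) ∧
      sylowSet (p i) (P i) + sylowSet (p j) (P j) = sylowSet (p j) (P j) + sylowSet (p i) (P i) ∧
      sylowSet (p j) (P j) + sylowSet (p i) (P i) = sylowSet (p j) (P j) * sylowSet (p i) (P i)) ∧
    (∀ i, ∃ Q : Sylow (p i) B, ((Q : Subgroup B) : Set B) = sylowSet (p i) (P i)) := by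
  have hinv : ∀ i a, ∀ b ∈ sylowSet (p i) (P i), lambdaMap a b ∈ sylowSet (p i) (P i) :=
    fun i a _ hb => hbrace.lambdaMap_mem_sylowSet (P i) a hb
  have hsum := exists_sum_mem_sylowSet p hp
    (fun q hq hdvd => (hfac q hq).1 (Nat.card_eq_fintype_card (α := B) ▸ hdvd)) P
  refine ⟨hsum, fun b => ?_, fun i j => ?_, fun i => ?_⟩
  · obtain ⟨f, hf, rfl⟩ := hsum b
    exact hbrace.exists_sum_eq_prod _ hinv f hf
  · exact ⟨hbrace.mul_eq_add_of_invariant _ (hinv j), add_comm _ _,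
      (hbrace.mul_eq_add_of_invariant _ (hinv i)).symm⟩
  · have := Fact.mk (hp i)
    exact ⟨Sylow.ofCard (hbrace.invariantSubgroup
      (Subgroup.toAddSubgroup' (P i : Subgroup (Multiplicative B))) (hinv i))
      (P i).card_eq_multiplicity, rfl⟩
end

section
/- Let B be a finite left brace with prime factors p_1, …, p_k of |B|, let B_i be the Sylow p_i-subgroup of the additive group (B,+), and let b_i ∈ B_i for each i. For i ≠ j, let a_{i,j} ∈ B_j and c_{i,j} ∈ B_i be the unique elements with b_i·b_j = a_{i,j}·c_{i,j} (they exist and are unique since B_i·B_j = B_j·B_i and B_i ∩ B_j = {0}). Then λ_{b_i}(b_j) = a_{i,j}. -/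
/-- The lambda map `λ_a` of a left brace as an endomorphism of the additive group. -/
def IsLeftBrace.lambdaHom_s11 {B : Type*} [AddCommGroup B] [Group B] (h : IsLeftBrace B) (a : B) :
    B →+ B :=
  AddMonoidHom.mk' (lambdaMap a) fun b c => by
    have := h a b c
    simp only [lambdaMap]
    rw [eq_sub_of_add_eq this]
    abel

theorem Sylow.exists_pow_nsmul_eq_zero {B : Type*} [AddCommGroup B] {p : ℕ}
    (P : Sylow p (Multiplicative B)) {b : B}
    (hb : Multiplicative.ofAdd b ∈ (P : Subgroup (Multiplicative B))) :
    ∃ n : ℕ, p ^ n • b = 0 := by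
  obtain ⟨n, hn⟩ := P.isPGroup' ⟨_, hb⟩
  exact ⟨n, Multiplicative.ofAdd.injective (congrArg Subtype.val hn)⟩

theorem exists_pow_nsmul_sub_eq_zero {B : Type*} [AddCommGroup B] {p : ℕ} {x y : B}
    (hx : ∃ n : ℕ, p ^ n • x = 0) (hy : ∃ n : ℕ, p ^ n • y = 0) :
    ∃ n : ℕ, p ^ n • (x - y) = 0 := by
  obtain ⟨m, hm⟩ := hx
  obtain ⟨n, hn⟩ := hy
  refine ⟨m + n, ?_⟩
  rw [nsmul_sub, pow_add, mul_nsmul, hm, mul_nsmul', hn, nsmul_zero, nsmul_zero, sub_zero]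

theorem exists_pow_nsmul_map_eq_zero {A B : Type*} [AddCommGroup A] [AddCommGroup B] {p : ℕ}
    (f : A →+ B) {x : A} (hx : ∃ n : ℕ, p ^ n • x = 0) : ∃ n : ℕ, p ^ n • f x = 0 :=
  hx.imp fun n hn => by rw [← map_nsmul, hn, map_zero]

theorem eq_zero_of_pow_nsmul_eq_zero_of_coprime {B : Type*} [AddCommGroup B] {p q : ℕ}
    (hpq : p.Coprime q) {x : B} (hp : ∃ n : ℕ, p ^ n • x = 0) (hq : ∃ n : ℕ, q ^ n • x = 0) :
    x = 0 := by
  obtain ⟨m, hm⟩ := hp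
  obtain ⟨n, hn⟩ := hq
  rw [← AddMonoid.addOrderOf_eq_one_iff]
  exact Nat.eq_one_of_dvd_coprimes (hpq.pow m n) (addOrderOf_dvd_of_nsmul_eq_zero hm)
    (addOrderOf_dvd_of_nsmul_eq_zero hn)

/-- let `B` be a finite left brace, `p ≠ q` primes, `P`, `Q` the Sylow
`p`- and `q`-subgroups of the additive group `(B,+)`, `b_i ∈ P`, `b_j ∈ Q`, and
`a ∈ Q`, `c ∈ P` the (unique) elements with `b_i·b_j = a·c`.  Then `λ_{b_i}(b_j) = a`. -/
theorem lambda_eq_of_sylow_decomposition {B : Type*} [Fintype B] [AddCommGroup B] [Group B]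
    (hbrace : IsLeftBrace B) (p q : ℕ) (hp : p.Prime) (hq : q.Prime) (hpq : p ≠ q)
    (P : Sylow p (Multiplicative B)) (Q : Sylow q (Multiplicative B))
    (bi bj a c : B)
    (hbi : Multiplicative.ofAdd bi ∈ (P : Subgroup (Multiplicative B)))
    (hbj : Multiplicative.ofAdd bj ∈ (Q : Subgroup (Multiplicative B)))
    (ha : Multiplicative.ofAdd a ∈ (Q : Subgroup (Multiplicative B)))
    (hc : Multiplicative.ofAdd c ∈ (P : Subgroup (Multiplicative B)))
    (hdec : bi * bj = a * c) :
    lambdaMap bi bj = a := by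
  have hsub : lambdaMap bi bj - a = lambdaMap a c - bi := by
    simp only [lambdaMap, hdec]
    abel
  have hQ := exists_pow_nsmul_sub_eq_zero
    (exists_pow_nsmul_map_eq_zero (hbrace.lambdaHom_s11 bi) (Q.exists_pow_nsmul_eq_zero hbj))
    (Q.exists_pow_nsmul_eq_zero ha)
  have hP := exists_pow_nsmul_sub_eq_zero
    (exists_pow_nsmul_map_eq_zero (hbrace.lambdaHom_s11 a) (P.exists_pow_nsmul_eq_zero hc))
    (P.exists_pow_nsmul_eq_zero hbi)
  change ∃ n : ℕ, p ^ n • (lambdaMap a c - bi) = 0 at hP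
  rw [← hsub] at hP
  exact sub_eq_zero.mp
    (eq_zero_of_pow_nsmul_eq_zero_of_coprime ((Nat.coprime_primes hp hq).mpr hpq) hP hQ)
end

section
/- Let (X,r) be a finite irretractable involutive non-degenerate set-theoretic solution of the Yang–Baxter equation, and let 𝒢 = 𝒢(X,r) with its natural left brace structure. Then soc(𝒢) = {0}; that is, the only element g ∈ 𝒢 with g·h = g + h for all h ∈ 𝒢 is the identity. -/
/-- The permutation `σ_x` of `X`, for a solution `(X,r)`. -/
noncomputable def sigmaPerm {X : Type*} (r : X × X → X × X) (h : IsYBSolution r) (x : X) :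
    Equiv.Perm X := Equiv.ofBijective (sigmaMap r x) (h.2.1 x)

/-- The permutation group `𝒢(X,r) = ⟨σ_x ∣ x ∈ X⟩ ≤ Sym_X` of a solution `(X,r)`. -/
noncomputable def permGroup {X : Type*} (r : X × X → X × X) (h : IsYBSolution r) :
    Subgroup (Equiv.Perm X) := Subgroup.closure (Set.range (sigmaPerm r h))

/-- The generator `σ_x` as an element of `𝒢(X,r)`. -/
noncomputable def sigmaEl {X : Type*} (r : X × X → X × X) (h : IsYBSolution r) (x : X) :
    ↥(permGroup r h) :=
  ⟨sigmaPerm r h x, Subgroup.subset_closure (Set.mem_range_self x)⟩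

theorem IsLeftBrace.one_eq_zero_s16 {B : Type*} [AddCommGroup B] [Group B] (hB : IsLeftBrace B) :
    (1 : B) = 0 := by
  simpa using hB 1 0 0

theorem IsLeftBrace.lambdaMap_one_s16 {B : Type*} [AddCommGroup B] [Group B] (hB : IsLeftBrace B)
    (b : B) : lambdaMap 1 b = b := by
  rw [lambdaMap, one_mul, hB.one_eq_zero_s16, sub_zero]

theorem IsLeftBrace.lambdaMap_mul_s16 {B : Type*} [AddCommGroup B] [Group B] (hB : IsLeftBrace B)
    (a b c : B) : lambdaMap (a * b) c = lambdaMap a (lambdaMap b c) := by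
  have key := hB a (b * c - b) b
  rw [sub_add_cancel] at key
  simp only [lambdaMap, mul_assoc]
  rw [sub_eq_sub_iff_add_eq_add, key]

/-- The action of `𝒢(X,r)` on the generators `σ_y` through the lambda map is the natural action
of `𝒢(X,r)` on `X`. -/
theorem lambdaMap_sigmaEl {X : Type*} (r : X × X → X × X) (h : IsYBSolution r)
    [AddCommGroup ↥(permGroup r h)] (hbrace : IsLeftBrace ↥(permGroup r h))
    (hgen : ∀ x y : X,
      lambdaMap (sigmaEl r h x) (sigmaEl r h y) = sigmaEl r h (sigmaMap r x y))
    (g : ↥(permGroup r h)) (y : X) :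
    lambdaMap g (sigmaEl r h y) = sigmaEl r h (g.1 y) := by
  obtain ⟨g, hg⟩ := g
  induction hg using Subgroup.closure_induction generalizing y with
  | mem g hg =>
    obtain ⟨x, rfl⟩ := hg
    exact hgen x y
  | one => exact hbrace.lambdaMap_one_s16 _
  | mul a b ha hb iha ihb =>
    have := hbrace.lambdaMap_mul_s16 ⟨a, ha⟩ ⟨b, hb⟩ (sigmaEl r h y)
    rw [ihb, iha] at this
    exact this
  | inv a ha iha =>
    have := hbrace.lambdaMap_mul_s16 (⟨a, ha⟩ : ↥(permGroup r h))⁻¹ ⟨a, ha⟩ (sigmaEl r h (a⁻¹ y))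
    rw [iha, inv_mul_cancel, hbrace.lambdaMap_one_s16] at this
    rw [← Equiv.Perm.mul_apply, mul_inv_cancel, Equiv.Perm.one_apply] at this
    exact this.symm

theorem sigmaEl_injective {X : Type*} (r : X × X → X × X) (h : IsYBSolution r)
    (hirr : ∀ x y : X, x ≠ y → sigmaMap r x ≠ sigmaMap r y) :
    Function.Injective (sigmaEl r h) := by
  intro x y hxy
  by_contra hne
  exact hirr x y hne (congrArg (fun g : ↥(permGroup r h) => (g.1 : X → X)) hxy)

/-- let `(X,r)` be a finite irretractable solution of the YBE and
`𝒢 = 𝒢(X,r)` with its natural left brace structure.  Then `soc(𝒢) = {0}`: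
the only `g ∈ 𝒢` with `g·h = g + h` for all `h ∈ 𝒢` is the identity. -/
theorem socle_trivial_of_irretractable {X : Type*} [Finite X]
    (r : X × X → X × X) (h : IsYBSolution r)
    (hirr : ∀ x y : X, x ≠ y → sigmaMap r x ≠ sigmaMap r y)
    [AddCommGroup ↥(permGroup r h)] (hbrace : IsLeftBrace ↥(permGroup r h))
    (hgen : ∀ x y : X,
      lambdaMap (sigmaEl r h x) (sigmaEl r h y) = sigmaEl r h (sigmaMap r x y)) :
    ∀ g : ↥(permGroup r h), (∀ b : ↥(permGroup r h), g * b = g + b) → g = 1 := by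
  intro g hg
  ext y
  apply sigmaEl_injective r h hirr
  rw [← lambdaMap_sigmaEl r h hbrace hgen, lambdaMap, hg, add_sub_cancel_left]
  rfl
end

section
/- Let (X,r) be a finite primitive involutive non-degenerate set-theoretic solution of the Yang–Baxter equation with |X| > 1. Then |X| is a prime number. -/
/-- A group `G` acts primitively on `X` if the action is transitive and every
block of the action is trivial (a subsingleton or all of `X`). -/
def IsPrimitiveAction (G : Type*) (X : Type*) [Group G] [MulAction G X] : Prop :=
  MulAction.IsPretransitive G X ∧ ∀ B : Set X, MulAction.IsBlock G B → MulAction.IsTrivialBlock B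

/-- A finite solution `(X,r)` is primitive if `𝒢(X,r)` acts primitively on `X`. -/
noncomputable def IsPrimitiveSolution {X : Type*} (r : X × X → X × X) (h : IsYBSolution r) : Prop :=
  IsPrimitiveAction ↥(permGroup r h) X

/-- If the average of finitely many roots of unity is an algebraic integer, then it vanishes or all
the roots of unity coincide with it. -/
theorem eq_zero_or_forall_eq_of_isIntegral_average {ι : Type*} [Fintype ι] {k : ℕ} (hk : 0 < k)
    (f : ι → ℂ) (hf : ∀ i, f i ^ k = 1) (α : ℂ) (hα : (Fintype.card ι : ℂ) * α = ∑ i, f i)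
    (hint : IsIntegral ℤ α) : α = 0 ∨ ∀ i, f i = α := by
  classical
  rcases isEmpty_or_nonempty ι with hι | hι
  · exact Or.inr fun i => (hι.false i).elim
  have hcard : (Fintype.card ι : ℂ) ≠ 0 := by exact_mod_cast Fintype.card_ne_zero
  refine or_iff_not_imp_left.2 fun hα0 => ?_
  let K : IntermediateField ℚ ℂ := IntermediateField.adjoin ℚ (Set.range f)
  have hfin : FiniteDimensional ℚ K := by
    refine IntermediateField.finiteDimensional_adjoin ?_
    rintro _ ⟨i, rfl⟩
    exact IsIntegral.of_pow hk (by rw [hf]; exact isIntegral_one)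
  have : NumberField K := ⟨⟩
  let F : ι → K := fun i => ⟨f i, IntermediateField.subset_adjoin ℚ _ ⟨i, rfl⟩⟩
  have hF : ∀ i, F i ^ k = 1 := fun i => Subtype.ext (by simpa [F] using hf i)
  let a : K := (Fintype.card ι : K)⁻¹ * ∑ i, F i
  have ha : (a : ℂ) = α := by
    have : (a : ℂ) = (Fintype.card ι : ℂ)⁻¹ * ∑ i, f i := by
      simp [a, F]
    rw [this, ← hα, inv_mul_cancel_left₀ hcard]
  have ha0 : a ≠ 0 := by
    intro h0
    rw [h0] at ha
    exact hα0 (by simpa using ha.symm)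
  have haint : IsIntegral ℤ a := by
    have h2 : IsIntegral ℤ (algebraMap K ℂ a) := by
      change IsIntegral ℤ (a : ℂ)
      rwa [ha]
    exact (isIntegral_algebraMap_iff (algebraMap K ℂ).injective).1 h2
  have hle : ∀ φ : K →+* ℂ, ‖φ a‖ ≤ 1 := by
    intro φ
    have h1 : ∀ i, ‖φ (F i)‖ = 1 := fun i =>
      Complex.norm_eq_one_of_pow_eq_one (by rw [← map_pow, hF, map_one]) hk.ne'
    have h2 : ‖∑ i, φ (F i)‖ ≤ Fintype.card ι := by
      refine (norm_sum_le _ _).trans ?_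
      simp [h1]
    have h3 : (0 : ℝ) < Fintype.card ι := by exact_mod_cast Fintype.card_pos
    simp only [a, map_mul, map_inv₀, map_natCast, map_sum, norm_mul, norm_inv, Complex.norm_natCast]
    rw [inv_mul_le_iff₀ h3, mul_one]
    exact h2
  obtain ⟨n, hn, hpow⟩ := NumberField.Embeddings.pow_eq_one_of_norm_le_one K ℂ ha0 haint hle
  have hnorm : ‖α‖ = 1 := by
    refine Complex.norm_eq_one_of_pow_eq_one (n := n) ?_ hn.ne'
    rw [← ha]
    exact_mod_cast congrArg (fun z : K => (z : ℂ)) hpow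
  have hfn : ∀ i, ‖f i‖ = 1 := fun i => Complex.norm_eq_one_of_pow_eq_one (hf i) hk.ne'
  have hαα : (starRingEnd ℂ α) * α = 1 := by
    rw [mul_comm, Complex.mul_conj, Complex.normSq_eq_norm_sq, hnorm]; simp
  have hsum : ∑ i, (1 - ((starRingEnd ℂ α) * f i).re) = 0 := by
    rw [Finset.sum_sub_distrib, ← Complex.re_sum, ← Finset.mul_sum, ← hα, mul_left_comm, hαα]
    simp
  have hnn : ∀ i, ‖(starRingEnd ℂ α) * f i‖ = 1 := fun i => by
    rw [norm_mul, RCLike.norm_conj, hnorm, hfn, one_mul]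
  intro i
  have hre := (Finset.sum_eq_zero_iff_of_nonneg fun i _ =>
    sub_nonneg.2 ((Complex.re_le_norm _).trans (hnn i).le)).1 hsum i (Finset.mem_univ i)
  have h1 : (starRingEnd ℂ α) * f i = 1 := by
    have hr : ((starRingEnd ℂ α) * f i).re = 1 := by linarith
    have him := Complex.abs_re_eq_norm.1 (by rw [hnn i, hr, abs_one])
    exact Complex.ext hr him
  calc f i = α * (starRingEnd ℂ α * f i) := by rw [← mul_assoc, mul_comm α, hαα, one_mul]
    _ = α := by rw [h1, mul_one]

/-- The eigenvalues of a complex matrix of finite order are roots of unity. -/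
theorem Matrix.pow_eq_one_of_mem_roots_charpoly {d k : ℕ} {M : Matrix (Fin d) (Fin d) ℂ}
    (hM : M ^ k = 1) {z : ℂ} (hz : z ∈ M.charpoly.roots) : z ^ k = 1 := by
  rcases Nat.eq_zero_or_pos d with rfl | hd
  · simp [Matrix.charpoly] at hz
  have : NeZero d := ⟨hd.ne'⟩
  have h1 := Matrix.mem_spectrum_of_isRoot_charpoly (Polynomial.isRoot_of_mem_roots hz)
  have h2 := spectrum.subset_polynomial_aeval M (Polynomial.X ^ k : Polynomial ℂ) ⟨z, h1, rfl⟩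
  simpa [hM] using h2

/-- The trace of a complex matrix of finite order is an algebraic integer. -/
theorem Matrix.isIntegral_trace_of_pow_eq_one {d k : ℕ} (hk : 0 < k)
    (M : Matrix (Fin d) (Fin d) ℂ) (hM : M ^ k = 1) : IsIntegral ℤ M.trace := by
  rw [Matrix.trace_eq_sum_roots_charpoly]
  refine IsIntegral.multiset_sum fun z hz => IsIntegral.of_pow hk ?_
  rw [M.pow_eq_one_of_mem_roots_charpoly hM hz]
  exact isIntegral_one

/-- A complex matrix of finite order whose normalized trace is an algebraic integer has trace zero
or is scalar. -/
theorem Matrix.trace_eq_zero_or_eq_scalar {d k : ℕ} [NeZero d] (hk : 0 < k)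
    (M : Matrix (Fin d) (Fin d) ℂ) (hM : M ^ k = 1) (α : ℂ) (hα : (d : ℂ) * α = M.trace)
    (hint : IsIntegral ℤ α) : M.trace = 0 ∨ M = algebraMap ℂ _ α := by
  classical
  have hdvd : minpoly ℂ M ∣ Polynomial.X ^ k - 1 := minpoly.dvd _ _ (by simp [hM])
  have hsqf : Squarefree (minpoly ℂ M) := by
    refine Squarefree.squarefree_of_dvd hdvd ?_
    exact (Polynomial.separable_X_pow_sub_C (1 : ℂ) (by exact_mod_cast hk.ne') one_ne_zero).squarefree
  have hcard : M.charpoly.roots.card = d := by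
    rw [← (IsAlgClosed.splits M.charpoly).natDegree_eq_card_roots, Matrix.charpoly_natDegree_eq_dim,
      Fintype.card_fin]
  have hsum : M.trace = ∑ z : M.charpoly.roots, (z : ℂ) := by
    rw [Matrix.trace_eq_sum_roots_charpoly, Multiset.sum_eq_sum_coe]
  rcases eq_zero_or_forall_eq_of_isIntegral_average hk (fun z : M.charpoly.roots => (z : ℂ))
    (fun z => M.pow_eq_one_of_mem_roots_charpoly hM Multiset.coe_mem) α
    (by rw [Multiset.card_coe, hcard, hα, hsum]) hint with h | h
  · left; rw [← hα, h, mul_zero]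
  right
  have hroots : M.charpoly.roots = Multiset.replicate d α := by
    refine Multiset.eq_replicate.2 ⟨hcard, fun z hz => ?_⟩
    exact h ⟨z, ⟨0, Multiset.count_pos.2 hz⟩⟩
  have hch : M.charpoly = (Polynomial.X - Polynomial.C α) ^ d := by
    rw [(IsAlgClosed.splits M.charpoly).eq_prod_roots_of_monic M.charpoly_monic, hroots]
    simp
  have h1 : minpoly ℂ M ∣ (Polynomial.X - Polynomial.C α) ^ d := hch ▸ M.minpoly_dvd_charpoly
  have h2 : minpoly ℂ M ∣ Polynomial.X - Polynomial.C α :=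
    (hsqf.dvd_pow_iff_dvd (NeZero.ne d)).1 h1
  have := (minpoly.dvd_iff).1 h2
  simpa [sub_eq_zero] using this

theorem trace_mulLeft_pi_matrix {ι : Type*} [Fintype ι] {d : ι → ℕ}
    (A : ∀ i, Matrix (Fin (d i)) (Fin (d i)) ℂ) :
    LinearMap.trace ℂ _ (LinearMap.mulLeft ℂ A) = ∑ i, (d i : ℂ) * (A i).trace := by
  classical
  rw [LinearMap.trace_eq_matrix_trace ℂ (Pi.basis fun i =>
    Matrix.stdBasis ℂ (Fin (d i)) (Fin (d i))), Matrix.trace, Fintype.sum_sigma]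
  refine Finset.sum_congr rfl fun i _ => ?_
  rw [Fintype.sum_prod_type, Matrix.trace, Finset.mul_sum]
  refine Finset.sum_congr rfl fun j _ => ?_
  have hkey : ∀ k : Fin (d i), LinearMap.toMatrix
      (Pi.basis fun i => Matrix.stdBasis ℂ (Fin (d i)) (Fin (d i)))
      (Pi.basis fun i => Matrix.stdBasis ℂ (Fin (d i)) (Fin (d i)))
      (LinearMap.mulLeft ℂ A) ⟨i, j, k⟩ ⟨i, j, k⟩ = A i j j := by
    intro k
    rw [LinearMap.toMatrix_apply, Pi.basis_repr, Pi.basis_apply, LinearMap.mulLeft_apply,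
      Pi.mul_apply, Pi.single_eq_same, Matrix.stdBasis_eq_single]
    change (A i * (Matrix.single j k 1 : Matrix (Fin (d i)) (Fin (d i)) ℂ)) j k = A i j j
    simp
  simp [Matrix.diag, hkey]

theorem MonoidAlgebra.trace_mulLeft_single {G : Type*} [Group G] [Fintype G] {g : G} (hg : g ≠ 1) :
    LinearMap.trace ℂ (MonoidAlgebra ℂ G) (LinearMap.mulLeft ℂ (MonoidAlgebra.single g 1)) = 0 := by
  classical
  rw [LinearMap.trace_eq_matrix_trace ℂ (MonoidAlgebra.basis G ℂ), Matrix.trace]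
  refine Finset.sum_eq_zero fun h _ => ?_
  rw [Matrix.diag_apply, LinearMap.toMatrix_apply, LinearMap.mulLeft_apply,
    MonoidAlgebra.basis_apply, MonoidAlgebra.single_mul_single]
  change (MonoidAlgebra.single (g * h) (1 * 1 : ℂ)).coeff h = 0
  simp [hg]

theorem trace_mulLeft_algEquiv {A B : Type*} [Ring A] [Algebra ℂ A] [Ring B] [Algebra ℂ B]
    (e : A ≃ₐ[ℂ] B) (a : A) :
    LinearMap.trace ℂ B (LinearMap.mulLeft ℂ (e a)) = LinearMap.trace ℂ A (LinearMap.mulLeft ℂ a) := by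
  rw [← LinearMap.trace_conj' (LinearMap.mulLeft ℂ a) e.toLinearEquiv]
  congr 1
  ext b
  simp [LinearEquiv.conj_apply]

open MonoidAlgebra in
/-- An element of the group algebra commuting with the group elements is mapped to a scalar by any
surjection onto a matrix algebra. -/
theorem MonoidAlgebra.exists_map_eq_algebraMap {G : Type*} [Group G] {d : ℕ}
    (φ : MonoidAlgebra ℂ G →ₐ[ℂ] Matrix (Fin d) (Fin d) ℂ) (hφ : Function.Surjective φ)
    (c : MonoidAlgebra ℂ G) (hc : ∀ u : G, single u 1 * c = c * single u 1) :
    ∃ ω : ℂ, φ c = algebraMap ℂ _ ω := by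
  have hcomm : ∀ a : MonoidAlgebra ℂ G, a * c = c * a := by
    intro a
    induction a using MonoidAlgebra.induction_linear with
    | zero => simp
    | add f g hf hg => rw [add_mul, mul_add, hf, hg]
    | single u r =>
      have : (single u r : MonoidAlgebra ℂ G) = r • single u 1 := by simp
      rw [this, smul_mul_assoc, hc, mul_smul_comm]
  have hmem : φ c ∈ Subalgebra.center ℂ (Matrix (Fin d) (Fin d) ℂ) := by
    rw [Subalgebra.mem_center_iff]
    intro b
    obtain ⟨a, rfl⟩ := hφ b
    rw [← map_mul, hcomm, map_mul]
  obtain ⟨ω, hω⟩ := (Algebra.IsCentral.mem_center_iff ℂ).1 hmem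
  exact ⟨ω, hω⟩

/-- The sum of the elements of the conjugacy class of `g`, in the group algebra. -/
noncomputable def conjClassSum (R : Type*) [Semiring R] {G : Type*} [Group G] [Fintype G]
    (g : G) : MonoidAlgebra R G :=
  open Classical in ∑ h : G with IsConj g h, MonoidAlgebra.single h 1

theorem single_mul_conjClassSum {G : Type*} [Group G] [Fintype G] (g u : G) :
    MonoidAlgebra.single u 1 * conjClassSum ℂ g = conjClassSum ℂ g * MonoidAlgebra.single u 1 := by
  classical
  simp only [conjClassSum, Finset.mul_sum, Finset.sum_mul, MonoidAlgebra.single_mul_single]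
  refine Finset.sum_bij (fun h _ => u * h * u⁻¹) ?_ ?_ ?_ ?_
  · intro h hh
    simp only [Finset.mem_filter, Finset.mem_univ, true_and] at hh ⊢
    exact hh.trans (isConj_iff.2 ⟨u, rfl⟩)
  · intro a _ b _ hab
    simpa using hab
  · intro h hh
    simp only [Finset.mem_filter, Finset.mem_univ, true_and] at hh
    refine ⟨u⁻¹ * h * u, ?_, by group⟩
    simp only [Finset.mem_filter, Finset.mem_univ, true_and]
    exact hh.trans (isConj_iff.2 ⟨u⁻¹, by group⟩)
  · intro h _
    simp

/-- The average of the group elements, in the complex group algebra. -/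
noncomputable def groupAverage (G : Type*) [Group G] [Fintype G] : MonoidAlgebra ℂ G :=
  (Fintype.card G : ℂ)⁻¹ • ∑ h : G, MonoidAlgebra.single h 1

theorem single_mul_groupAverage {G : Type*} [Group G] [Fintype G] (u : G) :
    MonoidAlgebra.single u 1 * groupAverage G = groupAverage G := by
  simp only [groupAverage, mul_smul_comm, Finset.mul_sum, MonoidAlgebra.single_mul_single, mul_one]
  congr 1
  exact Fintype.sum_equiv (Equiv.mulLeft u) _ _ fun h => rfl

theorem groupAverage_mul_single {G : Type*} [Group G] [Fintype G] (u : G) :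
    groupAverage G * MonoidAlgebra.single u 1 = groupAverage G := by
  simp only [groupAverage, smul_mul_assoc, Finset.sum_mul, MonoidAlgebra.single_mul_single, mul_one]
  congr 1
  exact Fintype.sum_equiv (Equiv.mulRight u) _ _ fun h => rfl

theorem trace_mulLeft_groupAverage {G : Type*} [Group G] [Fintype G] :
    LinearMap.trace ℂ (MonoidAlgebra ℂ G) (LinearMap.mulLeft ℂ (groupAverage G)) = 1 := by
  classical
  have h1 : LinearMap.mulLeft ℂ (groupAverage G) =
      (Fintype.card G : ℂ)⁻¹ • ∑ h : G, LinearMap.mulLeft ℂ (MonoidAlgebra.single h (1 : ℂ)) := by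
    ext a
    simp [groupAverage, Finset.sum_mul]
  rw [h1, map_smul, map_sum, Finset.sum_eq_single 1
    (fun h _ hh => MonoidAlgebra.trace_mulLeft_single hh) (by simp), ← MonoidAlgebra.one_def,
    LinearMap.mulLeft_one, LinearMap.trace_id,
    Module.finrank_eq_card_basis (MonoidAlgebra.basis G ℂ), smul_eq_mul]
  exact inv_mul_cancel₀ (by exact_mod_cast Fintype.card_ne_zero)

open MonoidAlgebra in
/-- The contribution of one irreducible representation to the trace of a noncentral element with
conjugacy class of prime power size in the regular representation of a simple group. -/
theorem exists_isIntegral_mul_trace_eq {G : Type*} [Group G] [Fintype G] [IsSimpleGroup G]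
    {q m d : ℕ} [NeZero d] (hq : q.Prime) {g : G} (hg : g ∉ Subgroup.center G)
    (hcard : Nat.card (conjugatesOf g) = q ^ m)
    (φ : MonoidAlgebra ℂ G →ₐ[ℂ] Matrix (Fin d) (Fin d) ℂ) (hφ : Function.Surjective φ) :
    ∃ β : ℂ, IsIntegral ℤ β ∧
      (d : ℂ) * (φ (single g 1)).trace = d * (φ (groupAverage G)).trace + q * β := by
  classical
  let ρ : G →* Matrix (Fin d) (Fin d) ℂ := (φ : MonoidAlgebra ℂ G →* _).comp (of ℂ G)
  have hρ : ∀ h, φ (single h 1) = ρ h := fun h => rfl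
  have hd : (d : ℂ) ≠ 0 := by exact_mod_cast NeZero.ne d
  rcases IsSimpleGroup.eq_bot_or_eq_top_of_normal ρ.ker inferInstance with hker | hker
  · have havg : φ (groupAverage G) = 0 := by
      obtain ⟨ω, hω⟩ := exists_map_eq_algebraMap φ hφ (groupAverage G) fun u => by
        rw [single_mul_groupAverage, groupAverage_mul_single]
      have hne : ρ g ≠ 1 := fun h => hg <| by
        have : g ∈ ρ.ker := h
        rw [hker, Subgroup.mem_bot] at this
        rw [this]; exact one_mem _
      have h1 := congrArg φ (single_mul_groupAverage g)
      rw [map_mul, hρ, hω, ← Algebra.commutes, ← Algebra.smul_def] at h1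
      rw [hω]
      by_contra hω0
      have hω0' : ω ≠ 0 := by rintro rfl; simp at hω0
      refine hne (smul_right_injective _ hω0' ?_)
      simpa [Algebra.smul_def] using h1
    rw [havg, Matrix.trace_zero, mul_zero]
    have hk : 0 < orderOf g := orderOf_pos g
    have hpow : ρ g ^ orderOf g = 1 := by rw [← map_pow, pow_orderOf_eq_one, map_one]
    have hχ : IsIntegral ℤ (ρ g).trace := Matrix.isIntegral_trace_of_pow_eq_one hk _ hpow
    obtain ⟨ω, hω⟩ := exists_map_eq_algebraMap φ hφ (conjClassSum ℂ g) (single_mul_conjClassSum g)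
    have hsum : φ (conjClassSum ℂ g) = ∑ h : G with IsConj g h, ρ h := by
      simp [conjClassSum, hρ]
    have hωint : IsIntegral ℤ ω := by
      have h1 : IsIntegral ℤ (conjClassSum ℤ g) := IsIntegral.of_finite ℤ _
      have h2 := h1.map (MonoidAlgebra.lift ℤ (Matrix (Fin d) (Fin d) ℂ) G ρ)
      have h3 : MonoidAlgebra.lift ℤ (Matrix (Fin d) (Fin d) ℂ) G ρ (conjClassSum ℤ g) =
          algebraMap ℂ _ ω := by
        rw [← hω, hsum]
        simp [conjClassSum]
      rw [h3] at h2
      exact (isIntegral_algebraMap_iff (algebraMap ℂ (Matrix (Fin d) (Fin d) ℂ)).injective).1 h2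
    have htr : (d : ℂ) * ω = q ^ m * (ρ g).trace := by
      have h1 := congrArg Matrix.trace (hω.symm.trans hsum)
      rw [Matrix.trace_sum, Finset.sum_congr rfl (g := fun _ => (ρ g).trace)] at h1
      · have hc : (Finset.univ.filter fun h => IsConj g h).card = q ^ m := by
          rw [← hcard]
          exact (Nat.subtype_card _ fun x => by
            simp only [Finset.mem_filter, Finset.mem_univ, true_and]; rfl).symm
        rw [Finset.sum_const, hc] at h1
        simpa [Algebra.algebraMap_eq_smul_one, mul_comm] using h1
      · intro h hh
        obtain ⟨u, rfl⟩ := isConj_iff.1 (Finset.mem_filter.1 hh).2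
        rw [map_mul, Matrix.trace_mul_comm, ← map_mul]
        simp
    by_cases hqd : q ∣ d
    · obtain ⟨e, rfl⟩ := hqd
      refine ⟨e * (ρ g).trace, ?_, ?_⟩
      · exact (by simpa using isIntegral_algebraMap (R := ℤ) (A := ℂ) (x := (e : ℤ)) :
          IsIntegral ℤ (e : ℂ)).mul hχ
      · rw [hρ]; push_cast; ring
    · refine ⟨0, isIntegral_zero, ?_⟩
      rw [hρ, mul_zero, add_zero]
      have hcop : IsCoprime ((q : ℤ) ^ m) (d : ℤ) :=
        (Nat.isCoprime_iff_coprime.2 ((Nat.Prime.coprime_iff_not_dvd hq).2 hqd)).pow_left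
      obtain ⟨u, v, huv⟩ := hcop
      have hα : IsIntegral ℤ ((d : ℂ)⁻¹ * (ρ g).trace) := by
        have h1 : (d : ℂ)⁻¹ * (ρ g).trace = (u : ℂ) * ω + (v : ℂ) * (ρ g).trace := by
          have huv' : (u : ℂ) * q ^ m + v * d = 1 := by exact_mod_cast huv
          field_simp
          linear_combination (-(ρ g).trace) * huv' - u * htr
        rw [h1]
        have hZ : ∀ z : ℤ, IsIntegral ℤ (z : ℂ) := fun z => by
          simpa using isIntegral_algebraMap (R := ℤ) (A := ℂ) (x := z)
        exact ((hZ u).mul hωint).add ((hZ v).mul hχ)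
      rcases Matrix.trace_eq_zero_or_eq_scalar hk (ρ g) hpow _
        (mul_inv_cancel_left₀ hd _) hα with h | h
      · rw [h, mul_zero]
      · refine (hg (Subgroup.mem_center_iff.2 fun h' => ?_)).elim
        refine (MonoidHom.ker_eq_bot_iff ρ).1 hker ?_
        rw [map_mul, map_mul, h, Algebra.commutes]
  · refine ⟨0, isIntegral_zero, ?_⟩
    have hone : ∀ h, ρ h = 1 := fun h => by
      have : h ∈ ρ.ker := by rw [hker]; trivial
      exact this
    have : φ (groupAverage G) = 1 := by
      simp [groupAverage, hρ, hone, ← Nat.cast_smul_eq_nsmul ℂ]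
    rw [this, hρ, hone, mul_zero, add_zero]

/-- **Burnside's theorem on conjugacy classes**: in a finite simple group, an element whose
conjugacy class has prime power size is central. -/
theorem IsSimpleGroup.mem_center_of_card_conjugatesOf {G : Type*} [Group G] [Finite G]
    [IsSimpleGroup G] {q m : ℕ} (hq : q.Prime) (g : G)
    (hcard : Nat.card (conjugatesOf g) = q ^ m) : g ∈ Subgroup.center G := by
  classical
  have := Fintype.ofFinite G
  by_contra hg
  have hg1 : g ≠ 1 := by rintro rfl; exact hg (one_mem _)
  have : NeZero (Nat.card G : ℂ) := ⟨by exact_mod_cast Nat.card_pos.ne'⟩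
  obtain ⟨n, d, hd, ⟨e⟩⟩ :=
    IsSemisimpleRing.exists_algEquiv_pi_matrix_of_isAlgClosed ℂ (MonoidAlgebra ℂ G)
  choose β hβ hβe using fun i => exists_isIntegral_mul_trace_eq hq hg hcard
    ((Pi.evalAlgHom ℂ _ i).comp e.toAlgHom)
    ((Function.surjective_eval i).comp e.surjective)
  have h0 := MonoidAlgebra.trace_mulLeft_single hg1
  have h1 := trace_mulLeft_groupAverage (G := G)
  rw [← trace_mulLeft_algEquiv e, trace_mulLeft_pi_matrix] at h0 h1
  have h2 := Finset.sum_congr (rfl : Finset.univ = Finset.univ) fun i _ => hβe i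
  rw [Finset.sum_add_distrib, ← Finset.mul_sum] at h2
  replace h2 : (0 : ℂ) = 1 + q * ∑ i, β i := h0.symm.trans (h2.trans (congrArg (· + _) h1))
  have hint : IsIntegral ℤ (algebraMap ℚ ℂ ((q : ℚ)⁻¹)) := by
    have hq0 : (q : ℂ) ≠ 0 := by exact_mod_cast hq.ne_zero
    have h3 : algebraMap ℚ ℂ ((q : ℚ)⁻¹) = -∑ i, β i := by
      simp only [map_inv₀, map_natCast]
      field_simp
      linear_combination -h2
    rw [h3]
    exact (IsIntegral.sum _ fun i _ => hβ i).neg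
  obtain ⟨z, hz⟩ := IsIntegrallyClosed.isIntegral_iff.1
    ((isIntegral_algebraMap_iff (algebraMap ℚ ℂ).injective).1 hint)
  have hq0 : (q : ℚ) ≠ 0 := by exact_mod_cast hq.ne_zero
  have hzq : (z : ℚ) * q = 1 := by
    rw [show (z : ℚ) = (q : ℚ)⁻¹ from hz, inv_mul_cancel₀ hq0]
  have hzq' : z * (q : ℤ) = 1 := by exact_mod_cast hzq
  have := Int.isUnit_iff.1 (IsUnit.of_mul_eq_one_right _ hzq')
  have := hq.two_le
  omega

/-- In a finite simple group whose order has at most two prime divisors, the center is nontrivial. -/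
theorem IsSimpleGroup.center_ne_bot_of_prime_dvd {G : Type*} [Group G] [Finite G]
    [IsSimpleGroup G] {p q : ℕ} (hp : p.Prime) (hq : q.Prime) (hpG : p ∣ Nat.card G)
    (h : ∀ r : ℕ, r.Prime → r ∣ Nat.card G → r = p ∨ r = q) : Subgroup.center G ≠ ⊥ := by
  have := Fact.mk hp
  let P : Sylow p G := default
  have : Finite (ConjAct G) := inferInstanceAs (Finite G)
  have hP : Nontrivial P := by
    rw [← Finite.one_lt_card_iff_nontrivial]
    exact (hp.one_lt).trans_le (Nat.le_of_dvd Nat.card_pos (P.dvd_card_of_dvd_card hpG))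
  have := P.isPGroup'.center_nontrivial
  obtain ⟨z, hz⟩ := exists_ne (1 : Subgroup.center P)
  let g : G := ((z : P) : G)
  have hg1 : g ≠ 1 := fun hg => hz (by ext; exact hg)
  suffices hg : g ∈ Subgroup.center G by
    intro hbot
    rw [hbot, Subgroup.mem_bot] at hg
    exact hg1 hg
  have hcard : Nat.card (conjugatesOf g) = (MulAction.stabilizer (ConjAct G) g).index := by
    rw [MulAction.index_stabilizer, ConjAct.orbit_eq_carrier_conjClasses]
    congr 2
  have hle : (P : Subgroup G).map ((ConjAct.toConjAct : G ≃* ConjAct G) : G →* ConjAct G) ≤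
      MulAction.stabilizer (ConjAct G) g := by
    rintro _ ⟨x, hx, rfl⟩
    have hcomm := Subgroup.mem_center_iff.1 z.2 ⟨x, hx⟩
    have hcomm' : x * g = g * x := congrArg (Subtype.val) hcomm
    change x * g * x⁻¹ = g
    rw [hcomm', mul_inv_cancel_right]
  have hdvd : (MulAction.stabilizer (ConjAct G) g).index ∣ (P : Subgroup G).index := by
    have := Subgroup.index_dvd_of_le hle
    rwa [Subgroup.index_map_equiv] at this
  refine IsSimpleGroup.mem_center_of_card_conjugatesOf hq g (m := _) (hcard.trans <|
    Nat.eq_prime_pow_of_unique_prime_dvd Subgroup.index_ne_zero_of_finite fun {r} hr hrd => ?_)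
  refine (h r hr ((hrd.trans hdvd).trans (Subgroup.index_dvd_card _))).resolve_left ?_
  rintro rfl
  exact P.not_dvd_index (hrd.trans hdvd)

/-- **Burnside's theorem**: a finite group whose order has at most two prime divisors is
solvable. -/
theorem isSolvable_of_prime_dvd_card {G : Type*} [Group G] [Finite G] {p q : ℕ} (hp : p.Prime)
    (hq : q.Prime) (h : ∀ r : ℕ, r.Prime → r ∣ Nat.card G → r = p ∨ r = q) :
    Group.IsSolvable G := by
  induction hn : Nat.card G using Nat.strong_induction_on generalizing G with
  | _ n ih =>
  subst hn
  rcases subsingleton_or_nontrivial G with hG | hG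
  · infer_instance
  by_cases hK : ∃ K : Subgroup G, K.Normal ∧ K ≠ ⊥ ∧ K ≠ ⊤
  · obtain ⟨K, hKn, hbot, htop⟩ := hK
    have hmul := K.index_mul_card
    refine (Group.isSolvable_iff_subgroup_quotient K).2 ⟨?_, ?_⟩
    · refine ih _ ?_ (fun r hr hd => h r hr (hd.trans K.card_subgroup_dvd_card)) rfl
      exact lt_of_le_of_ne (Subgroup.card_le_card_group K) fun h => htop (K.card_eq_iff_eq_top.1 h)
    · have hd : Nat.card (G ⧸ K) ∣ Nat.card G := K.index_dvd_card
      refine ih _ ?_ (fun r hr hd' => h r hr (hd'.trans hd)) rfl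
      refine lt_of_le_of_ne (Nat.le_of_dvd Nat.card_pos hd) fun he => hbot ?_
      have h1 : 0 < Nat.card G := Nat.card_pos
      change K.index = _ at he
      rw [he] at hmul
      exact K.card_eq_one.1 (Nat.eq_of_mul_eq_mul_left h1 (by rw [hmul, mul_one]))
  · push Not at hK
    have : IsSimpleGroup G := ⟨fun K hKn => or_iff_not_imp_left.2 (hK K hKn)⟩
    have hc : Subgroup.center G ≠ ⊥ := by
      obtain ⟨r, hr, hrG⟩ := Nat.exists_prime_and_dvd (Finite.one_lt_card (α := G)).ne'
      rcases h r hr hrG with rfl | rfl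
      · exact IsSimpleGroup.center_ne_bot_of_prime_dvd hp hq hrG h
      · exact IsSimpleGroup.center_ne_bot_of_prime_dvd hq hp hrG fun s hs hsG => (h s hs hsG).symm
    have htop := hK _ inferInstance hc
    refine Group.isSolvable_of_comm fun a b => ?_
    have : a ∈ Subgroup.center G := by rw [htop]; trivial
    exact (Subgroup.mem_center_iff.1 this b).symm

/-- A nontrivial finite solvable group has a nontrivial normal `r`-subgroup for some prime `r`. -/
theorem Group.IsSolvable.exists_normal_isPGroup {G : Type*} [Group G] [Finite G] [Nontrivial G]
    [Group.IsSolvable G] :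
    ∃ (r : ℕ) (N : Subgroup G), r.Prime ∧ N.Normal ∧ N ≠ ⊥ ∧ IsPGroup r N := by
  classical
  obtain ⟨n, hn⟩ := (Group.isSolvable_def G).1 inferInstance
  have hex : ∃ n, derivedSeries G n = ⊥ := ⟨n, hn⟩
  set k := Nat.find hex with hk
  have hk0 : k ≠ 0 := fun h0 => by
    have := Nat.find_spec hex
    rw [← hk, h0, derivedSeries_zero] at this
    exact top_ne_bot this
  obtain ⟨l, hl⟩ := Nat.exists_eq_succ_of_ne_zero hk0
  set D := derivedSeries G l with hD
  have hDbot : D ≠ ⊥ := Nat.find_min hex (by omega)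
  have hcomm : ∀ a ∈ D, ∀ b ∈ D, a * b = b * a := by
    intro a ha b hb
    have h1 := Subgroup.commutator_mem_commutator ha hb
    have h2 := Nat.find_spec hex
    rw [← hk, hl, derivedSeries_succ] at h2
    rw [show ⁅D, D⁆ = ⊥ from h2, Subgroup.mem_bot, commutatorElement_eq_one_iff_mul_comm] at h1
    exact h1
  have hDn : D.Normal := derivedSeries_normal G l
  have hcard : Nat.card D ≠ 1 := fun h => hDbot (D.card_eq_one.1 h)
  obtain ⟨r, hr, hrD⟩ := Nat.exists_prime_and_dvd hcard
  have := Fact.mk hr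
  let N : Subgroup G :=
    { carrier := {a | a ∈ D ∧ a ^ r = 1}
      one_mem' := ⟨one_mem _, one_pow _⟩
      mul_mem' := fun {a b} ha hb =>
        ⟨mul_mem ha.1 hb.1, by
          rw [(show Commute a b from hcomm a ha.1 b hb.1).mul_pow, ha.2, hb.2, one_mul]⟩
      inv_mem' := fun {a} ha => ⟨inv_mem ha.1, by rw [inv_pow, ha.2, inv_one]⟩ }
  refine ⟨r, N, hr, ⟨fun a ha g => ⟨hDn.conj_mem a ha.1 g, ?_⟩⟩, ?_, ?_⟩
  · rw [conj_pow, ha.2, mul_one, mul_inv_cancel]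
  · obtain ⟨x, hx⟩ := exists_prime_orderOf_dvd_card' r hrD
    intro hbot
    have hxN : (x : G) ∈ N := ⟨x.2, by
      rw [← hx, ← Subgroup.orderOf_coe]; exact pow_orderOf_eq_one _⟩
    rw [hbot, Subgroup.mem_bot] at hxN
    have : x = 1 := Subtype.ext hxN
    rw [this, orderOf_one] at hx
    exact hr.one_lt.ne hx
  · intro a
    exact ⟨1, Subtype.ext (by simpa using a.2.2)⟩

open MulAction in
/-- An equivariant map out of a primitive action is injective or constant. -/
theorem MulAction.IsPreprimitive.injective_or_forall_eq {G X Y : Type*} [Group G] [MulAction G X]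
    [MulAction G Y] [IsPreprimitive G X] {f : X → Y} (hf : ∀ (g : G) x, f (g • x) = g • f x) :
    Function.Injective f ∨ ∀ x y, f x = f y := by
  have key : ∀ x, (f ⁻¹' {f x}).Subsingleton ∨ f ⁻¹' {f x} = Set.univ := by
    intro x
    refine IsPreprimitive.isTrivialBlock_of_isBlock (G := G) ?_
    let F : X →ₑ[(id : G → G)] Y := ⟨f, hf⟩
    exact (IsBlock.singleton (G := G) (a := f x)).preimage F
  by_cases h : ∃ x, f ⁻¹' {f x} = Set.univ
  · obtain ⟨x, hx⟩ := h
    have hx' : ∀ y, f y = f x := fun y => by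
      have : y ∈ f ⁻¹' {f x} := by rw [hx]; trivial
      exact this
    exact Or.inr fun y z => (hx' y).trans (hx' z).symm
  · push Not at h
    exact Or.inl fun x y hxy => (key x).resolve_right (h x) rfl hxy.symm

open MulAction in
/-- A nontrivial normal subgroup of a faithful primitive group is transitive. -/
theorem MulAction.IsPreprimitive.isPretransitive_of_ne_bot {G X : Type*} [Group G] [MulAction G X]
    [FaithfulSMul G X] [IsPreprimitive G X] (N : Subgroup G) [N.Normal] (hN : N ≠ ⊥) :
    IsPretransitive N X := by
  refine IsQuasiPreprimitive.isPretransitive_of_normal fun h => hN ?_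
  refine (Subgroup.eq_bot_iff_forall _).2 fun g hg => FaithfulSMul.eq_of_smul_eq_smul (α := X) ?_
  intro x
  have hx : x ∈ fixedPoints N X := by rw [h]; trivial
  rw [one_smul]
  exact hx ⟨g, hg⟩

/-- A nontrivial commutative faithful primitive group has prime degree. -/
theorem MulAction.IsPreprimitive.card_prime_of_comm {G X : Type*} [Group G] [Finite G]
    [MulAction G X] [FaithfulSMul G X] [IsPreprimitive G X] [Finite X] (hX : 1 < Nat.card X)
    (hcomm : ∀ g h : G, g * h = h * g) : (Nat.card X).Prime := by
  have : Nontrivial X := Finite.one_lt_card_iff_nontrivial.1 hX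
  have : Nontrivial G := by
    by_contra hG
    rw [not_nontrivial_iff_subsingleton] at hG
    obtain ⟨x, y, hxy⟩ := exists_pair_ne X
    obtain ⟨g, rfl⟩ := MulAction.exists_smul_eq G x y
    rw [Subsingleton.elim g 1, one_smul] at hxy
    exact hxy rfl
  obtain ⟨p, hp, hpG⟩ := Nat.exists_prime_and_dvd (Finite.one_lt_card (α := G)).ne'
  have := Fact.mk hp
  obtain ⟨g, hg⟩ := exists_prime_orderOf_dvd_card' p hpG
  have hn : (Subgroup.zpowers g).Normal :=
    ⟨fun a ha b => by rwa [hcomm b a, mul_inv_cancel_right]⟩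
  have hne : Subgroup.zpowers g ≠ ⊥ := by
    rw [Ne, Subgroup.zpowers_eq_bot]
    rintro rfl
    rw [orderOf_one] at hg
    exact hp.one_lt.ne hg
  have := isPretransitive_of_ne_bot (X := X) (Subgroup.zpowers g) hne
  obtain ⟨x⟩ : Nonempty X := inferInstance
  have hd := (MulAction.stabilizer (Subgroup.zpowers g) x).index_dvd_card
  rw [MulAction.index_stabilizer_of_transitive, Nat.card_zpowers, hg] at hd
  rw [((Nat.dvd_prime hp).1 hd).resolve_left hX.ne']
  exact hp

/-- The preimage of an invariant subgroup under a bijective crossed homomorphism. -/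
def crossedComap {G A : Type*} [Group G] [CommGroup A] [MulDistribMulAction G A] (c : G ≃ A)
    (hc : ∀ g h, c (g * h) = c g * g • c h) (U : Subgroup A)
    (hU : ∀ (g : G), ∀ a ∈ U, g • a ∈ U) : Subgroup G where
  carrier := {g | c g ∈ U}
  one_mem' := by
    have h := hc 1 1
    rw [one_smul, mul_one, left_eq_mul] at h
    change c 1 ∈ U
    rw [h]
    exact one_mem U
  mul_mem' {g h} hg hh := by
    change c (g * h) ∈ U
    rw [hc]
    exact mul_mem hg (hU _ _ hh)
  inv_mem' {g} hg := by
    change c g⁻¹ ∈ U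
    have h1 := hc 1 1
    rw [one_smul, mul_one, left_eq_mul] at h1
    have h := hc g⁻¹ g
    rw [inv_mul_cancel, h1] at h
    rw [eq_inv_of_mul_eq_one_left h.symm]
    exact inv_mem (hU _ _ hg)

section CrossedComap

variable {G A : Type*} [Group G] [CommGroup A] [MulDistribMulAction G A] {c : G ≃ A}
    {hc : ∀ g h, c (g * h) = c g * g • c h} {U E F : Subgroup A}
    {hU : ∀ (g : G), ∀ a ∈ U, g • a ∈ U} {hE : ∀ (g : G), ∀ a ∈ E, g • a ∈ E}
    {hF : ∀ (g : G), ∀ a ∈ F, g • a ∈ F}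

theorem mem_crossedComap {g : G} : g ∈ crossedComap c hc U hU ↔ c g ∈ U := Iff.rfl

theorem card_crossedComap : Nat.card (crossedComap c hc U hU) = Nat.card U :=
  Nat.card_congr (c.subtypeEquiv fun _ => Iff.rfl)

theorem IsPGroup.crossedComap [Finite A] {p : ℕ} [Fact p.Prime] (h : IsPGroup p U) :
    IsPGroup p (crossedComap c hc U hU) := by
  obtain ⟨n, hn⟩ := IsPGroup.iff_card.1 h
  exact IsPGroup.of_card (card_crossedComap.trans hn)

/-- For a `p`-subgroup `E` and a `q`-subgroup `F`, both invariant, a `p`-subgroup normalised by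
the preimage of `E ⊔ F` acts trivially on `F`. -/
theorem smul_eq_of_isPGroup [Finite A] {p q : ℕ} [Fact p.Prime] [Fact q.Prime]
    (hpq : p ≠ q) (hEp : IsPGroup p E) (hFq : IsPGroup q F) (hE : ∀ (g : G), ∀ a ∈ E, g • a ∈ E)
    (hF : ∀ (g : G), ∀ a ∈ F, g • a ∈ F) (hc : ∀ g h, c (g * h) = c g * g • c h)
    (N : Subgroup G) (hN : IsPGroup p N)
    (hNEF : ∀ n ∈ N, c n ∈ E ⊔ F) (hnorm : ∀ g, c g ∈ E ⊔ F → ∀ n ∈ N, g * n * g⁻¹ ∈ N) :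
    ∀ n ∈ N, ∀ b ∈ F, n • b = b := by
  set P := crossedComap c hc E hE with hP
  set Q := crossedComap c hc F hF with hQ
  have hPp : IsPGroup p P := hEp.crossedComap
  have hQq : IsPGroup q Q := hFq.crossedComap
  have hPN : P ≤ Subgroup.normalizer N := by
    intro g hg
    have hg' : c g ∈ E ⊔ F := (le_sup_left : E ≤ E ⊔ F) hg
    have hg'' : c g⁻¹ ∈ E ⊔ F := (le_sup_left : E ≤ E ⊔ F) (inv_mem hg)
    refine Subgroup.mem_normalizer_iff.2 fun n => ⟨hnorm g hg' n, fun h => ?_⟩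
    have := hnorm _ hg'' _ h
    simpa [mul_assoc] using this
  have hM : IsPGroup p (N ⊔ P : Subgroup G) := hN.to_sup_of_normal_left' hPp hPN
  have hdisj : ∀ {M : Subgroup G}, IsPGroup p M → ∀ u ∈ M, u ∈ Q → u = 1 := fun hM u h1 h2 =>
    Subgroup.disjoint_def.1 (IsPGroup.disjoint_of_ne p q hpq _ _ hM hQq) h1 h2
  have hNP : N ≤ P := by
    intro n hn
    obtain ⟨a, ha, b, hb, hab⟩ := Subgroup.mem_sup.1 (hNEF n hn)
    obtain ⟨s, rfl⟩ := c.surjective a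
    have h1 := hc s (s⁻¹ * n)
    rw [mul_inv_cancel_left, ← hab, mul_right_inj] at h1
    have hu : s⁻¹ * n ∈ Q := by
      rw [hQ, mem_crossedComap, ← inv_smul_smul s (c (s⁻¹ * n)), ← h1]
      exact hF _ _ hb
    have hs : s ∈ P := ha
    have hu1 := hdisj hM _ (mul_mem (inv_mem ((le_sup_right : P ≤ N ⊔ P) hs))
      ((le_sup_left : N ≤ N ⊔ P) hn)) hu
    rw [inv_mul_eq_one] at hu1
    exact hu1 ▸ hs
  have key : ∀ n ∈ N, ∀ β ∈ Q, (β * n * β⁻¹) • c β = c β := by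
    intro n hn β hβ
    obtain ⟨n', hn'⟩ := c.surjective (β • c n)
    have h1 := hc n' (n'⁻¹ * (β * n))
    rw [mul_inv_cancel_left, hc, ← hn', mul_comm, mul_right_inj] at h1
    have hβ' : n'⁻¹ * (β * n) ∈ Q := by
      rw [hQ, mem_crossedComap, ← inv_smul_smul n' (c (n'⁻¹ * (β * n))), ← h1]
      exact hF _ _ hβ
    have hn'P : n' ∈ P := by
      rw [hP, mem_crossedComap, hn']
      exact hE _ _ (hNP hn)
    have hβN : β * n * β⁻¹ ∈ P := hNP (hnorm β ((le_sup_right : F ≤ E ⊔ F) hβ) n hn)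
    have hone := hdisj hPp _ (mul_mem (inv_mem hn'P) hβN) (by
      rw [← mul_assoc]
      rw [← mul_assoc] at hβ'
      rw [← mul_assoc]
      exact mul_mem hβ' (inv_mem hβ))
    rw [inv_mul_eq_one] at hone
    have : n'⁻¹ * (β * n) = β := by rw [hone]; group
    rw [this, hone] at h1
    exact h1.symm
  intro n hn b hb
  obtain ⟨β, rfl⟩ := c.surjective b
  have hβ' : c β⁻¹ ∈ F := inv_mem (show β ∈ Q from hb)
  have := key (β⁻¹ * n * β⁻¹⁻¹) (hnorm _ ((le_sup_right : F ≤ E ⊔ F) hβ') n hn) β hb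
  simpa [mul_assoc] using this

end CrossedComap

theorem eq_one_of_forall_pow_ordCompl_eq_one {A : Type*} [CommGroup A] [Finite A] {d : A}
    (h : ∀ r : ℕ, r.Prime → d ^ (ordCompl[r] (Nat.card A)) = 1) : d = 1 := by
  rw [← orderOf_eq_one_iff]
  by_contra hd
  obtain ⟨r, hr, hrd⟩ := Nat.exists_prime_and_dvd hd
  exact Nat.not_dvd_ordCompl hr Nat.card_pos.ne' (hrd.trans (orderOf_dvd_of_pow_eq_one (h r hr)))

/-- The `p`-primary part of a finite commutative group, as the image of a power map. -/
noncomputable def primaryPart (A : Type*) [CommGroup A] (p : ℕ) : Subgroup A :=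
  (powMonoidHom (ordCompl[p] (Nat.card A)) : A →* A).range

theorem mem_primaryPart {A : Type*} [CommGroup A] {p : ℕ} {a : A} :
    a ∈ primaryPart A p ↔ ∃ b : A, b ^ (ordCompl[p] (Nat.card A)) = a := Iff.rfl

theorem isPGroup_primaryPart (A : Type*) [CommGroup A] (p : ℕ) :
    IsPGroup p (primaryPart A p) := by
  rintro ⟨_, b, rfl⟩
  refine ⟨(Nat.card A).factorization p, Subtype.ext ?_⟩
  change (b ^ _) ^ _ = 1
  rw [← pow_mul, mul_comm, Nat.ordProj_mul_ordCompl_eq_self, pow_card_eq_one']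

theorem smul_mem_primaryPart {G A : Type*} [Group G] [CommGroup A] [MulDistribMulAction G A]
    (p : ℕ) (g : G) : ∀ a ∈ primaryPart A p, g • a ∈ primaryPart A p := by
  rintro _ ⟨b, rfl⟩
  exact ⟨g • b, (smul_pow' g b _).symm⟩

theorem exists_mem_primaryPart_mul_eq {A : Type*} [CommGroup A] [Finite A] {p : ℕ} (hp : p.Prime)
    (c : A) : ∃ a ∈ primaryPart A p, ∃ b : A, b ^ (ordCompl[p] (Nat.card A)) = 1 ∧ a * b = c := by
  have hn : Nat.card A ≠ 0 := Nat.card_pos.ne'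
  have hcop : IsCoprime ((ordCompl[p] (Nat.card A) : ℕ) : ℤ)
      ((ordProj[p] (Nat.card A) : ℕ) : ℤ) :=
    Nat.isCoprime_iff_coprime.2 ((Nat.coprime_ordCompl hp hn).pow_left _).symm
  obtain ⟨u, v, huv⟩ := hcop
  refine ⟨_, ⟨c ^ u, rfl⟩, (c ^ v) ^ (ordProj[p] (Nat.card A)), ?_, ?_⟩
  · rw [← pow_mul, Nat.ordProj_mul_ordCompl_eq_self, pow_card_eq_one']
  · change (c ^ u) ^ _ * _ = c
    rw [← zpow_natCast, ← zpow_natCast, ← zpow_mul, ← zpow_mul, ← zpow_add, huv, zpow_one]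

/-- The data of a finite primitive cycle set: a faithful primitive group `G` with a bijective
crossed homomorphism to a commutative group generated by an equivariant image of `X`. -/
structure PrimitiveCrossedHom (G A X : Type*) [Group G] [CommGroup A] [MulDistribMulAction G A]
    [MulAction G X] where
  toEquiv : G ≃ A
  map_mul : ∀ g h, toEquiv (g * h) = toEquiv g * g • toEquiv h
  gen : X → A
  gen_smul : ∀ (g : G) x, gen (g • x) = g • gen x
  closure_gen : Subgroup.closure (Set.range gen) = ⊤

namespace PrimitiveCrossedHom

variable {G A X : Type*} [Group G] [Finite A] [CommGroup A] [MulDistribMulAction G A]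
  [MulAction G X] [FaithfulSMul G X] [MulAction.IsPreprimitive G X] [Finite X]
  (c : PrimitiveCrossedHom G A X)

include c in
omit [Finite A] [FaithfulSMul G X] [MulAction.IsPreprimitive G X] [Finite X] in
theorem smul_pow_eq {m : ℕ} (h : ∀ x y, c.gen x ^ m = c.gen y ^ m) (g : G) (a : A) :
    g • a ^ m = a ^ m := by
  have : (MulDistribMulAction.toMonoidHom A g).comp (powMonoidHom m) = powMonoidHom m := by
    refine MonoidHom.eq_of_eqOn_dense c.closure_gen ?_
    rintro _ ⟨x, rfl⟩
    change g • c.gen x ^ m = c.gen x ^ m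
    rw [smul_pow', ← c.gen_smul]
    exact h _ _
  exact DFunLike.congr_fun this a

omit [Finite A] [FaithfulSMul G X] [Finite X] in
theorem injective_pow_or (m : ℕ) : (Function.Injective fun x => c.gen x ^ m) ∨
    ∀ x y, c.gen x ^ m = c.gen y ^ m :=
  MulAction.IsPreprimitive.injective_or_forall_eq (G := G) fun g x => by
    rw [c.gen_smul, smul_pow']

omit [Finite A] [MulAction.IsPreprimitive G X] [Finite X] in
theorem eq_one_of_smul_eq {m : ℕ} (h : Function.Injective fun x => c.gen x ^ m) {g : G}
    (hg : ∀ a : A, g • a ^ m = a ^ m) : g = 1 := by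
  refine FaithfulSMul.eq_of_smul_eq_smul (α := X) fun x => h ?_
  change c.gen (g • x) ^ m = c.gen ((1 : G) • x) ^ m
  rw [c.gen_smul, ← smul_pow', hg, one_smul]

omit [MulAction.IsPreprimitive G X] [Finite X] in
/-- At most one primary part carries a faithful copy of `X`. -/
theorem eq_of_injective_pow [Nontrivial X] {p q : ℕ} (hp : p.Prime) (hq : q.Prime)
    (hpi : Function.Injective fun x => c.gen x ^ (ordCompl[p] (Nat.card A)))
    (hqi : Function.Injective fun x => c.gen x ^ (ordCompl[q] (Nat.card A))) : p = q := by
  by_contra hpq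
  have := Fact.mk hp
  have := Fact.mk hq
  have : Finite G := Finite.of_equiv A c.toEquiv.symm
  set E := primaryPart A p with hE
  set F := primaryPart A q with hF
  have hJ : ∀ (g : G), ∀ a ∈ E ⊔ F, g • a ∈ E ⊔ F := by
    intro g j hj
    obtain ⟨a, ha, b, hb, rfl⟩ := Subgroup.mem_sup.1 hj
    rw [smul_mul']
    exact Subgroup.mul_mem_sup (smul_mem_primaryPart p g a ha) (smul_mem_primaryPart q g b hb)
  set H := crossedComap c.toEquiv c.map_mul (E ⊔ F) hJ with hH
  have hprime : ∀ r : ℕ, r.Prime → r ∣ Nat.card H → r = p ∨ r = q := by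
    intro r hr hrH
    have := Fact.mk hr
    rw [hH, card_crossedComap] at hrH
    obtain ⟨j, hj⟩ := exists_prime_orderOf_dvd_card' r hrH
    obtain ⟨a, ha, b, hb, hab⟩ := Subgroup.mem_sup.1 j.2
    obtain ⟨k, hk⟩ := isPGroup_primaryPart A p ⟨a, ha⟩
    obtain ⟨l, hl⟩ := isPGroup_primaryPart A q ⟨b, hb⟩
    have hk' : a ^ p ^ k = 1 := congrArg Subtype.val hk
    have hl' : b ^ q ^ l = 1 := congrArg Subtype.val hl
    have hd : r ∣ p ^ k * q ^ l := by
      rw [← hj, ← Subgroup.orderOf_coe, ← hab]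
      refine orderOf_dvd_of_pow_eq_one ?_
      rw [mul_pow, pow_mul, hk', one_pow, mul_comm (p ^ k), pow_mul, hl', one_pow, one_mul]
    rcases (Nat.Prime.dvd_mul hr).1 hd with h | h
    · exact Or.inl ((Nat.prime_dvd_prime_iff_eq hr hp).1 (hr.dvd_of_dvd_pow h))
    · exact Or.inr ((Nat.prime_dvd_prime_iff_eq hr hq).1 (hr.dvd_of_dvd_pow h))
  have hsolv : Group.IsSolvable H := isSolvable_of_prime_dvd_card hp hq hprime
  have hnt : Nontrivial H := by
    obtain ⟨x, y, hxy⟩ := exists_pair_ne X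
    have hmem : ∀ x, c.gen x ^ (ordCompl[p] (Nat.card A)) ∈ E ⊔ F := fun x =>
      (le_sup_left : E ≤ E ⊔ F) (mem_primaryPart.2 ⟨_, rfl⟩)
    have hmem' : ∀ x, c.toEquiv.symm (c.gen x ^ (ordCompl[p] (Nat.card A))) ∈ H := fun x => by
      rw [hH, mem_crossedComap, Equiv.apply_symm_apply]
      exact hmem x
    refine ⟨⟨_, hmem' x⟩, ⟨_, hmem' y⟩, fun h => hxy (hpi ?_)⟩
    exact c.toEquiv.symm.injective (congrArg Subtype.val h)
  obtain ⟨r, N, hr, hN, hNbot, hNr⟩ := Group.IsSolvable.exists_normal_isPGroup (G := H)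
  have hrH : r ∣ Nat.card H := by
    have := Fact.mk hr
    obtain ⟨n, hn⟩ := IsPGroup.iff_card.1 hNr
    refine dvd_trans ?_ N.card_subgroup_dvd_card
    rw [hn]
    refine dvd_pow_self r ?_
    rintro rfl
    exact hNbot (N.card_eq_one.1 hn)
  have hN'r : IsPGroup r (N.map H.subtype) := hNr.map _
  have hmemN : ∀ n ∈ N.map H.subtype, c.toEquiv n ∈ E ⊔ F := by
    rintro _ ⟨n, hn, rfl⟩
    exact n.2
  have hnorm : ∀ g, c.toEquiv g ∈ E ⊔ F → ∀ n ∈ N.map H.subtype, g * n * g⁻¹ ∈ N.map H.subtype := by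
    rintro g hg _ ⟨n, hn, rfl⟩
    exact ⟨_, hN.conj_mem n hn ⟨g, hg⟩, rfl⟩
  have hbot : N.map H.subtype = ⊥ := by
    refine (Subgroup.eq_bot_iff_forall _).2 fun n hn => ?_
    rcases hprime r hr hrH with rfl | rfl
    · refine c.eq_one_of_smul_eq hqi fun a => ?_
      exact smul_eq_of_isPGroup hpq (isPGroup_primaryPart A r) (isPGroup_primaryPart A q)
        (smul_mem_primaryPart r) (smul_mem_primaryPart q) c.map_mul _ hN'r hmemN hnorm n hn _
        ⟨a, rfl⟩
    · rw [sup_comm] at hmemN hnorm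
      refine c.eq_one_of_smul_eq hpi fun a => ?_
      exact smul_eq_of_isPGroup (Ne.symm hpq) (isPGroup_primaryPart A r)
        (isPGroup_primaryPart A p) (smul_mem_primaryPart r) (smul_mem_primaryPart p)
        c.map_mul _ hN'r hmemN hnorm n hn _ ⟨a, rfl⟩
  exact hNbot ((Subgroup.map_eq_bot_iff_of_injective _ H.subtype_injective).1 hbot)

/-- If `G` acts trivially on the part prime to `p`, then the `p`-primary part does not carry a
faithful copy of `X`. -/
theorem not_injective_pow [Nontrivial X] {p : ℕ} (hp : p.Prime)
    (htriv : ∀ (g : G) (b : A), b ^ (ordCompl[p] (Nat.card A)) = 1 → g • b = b) :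
    ¬ Function.Injective fun x => c.gen x ^ (ordCompl[p] (Nat.card A)) := by
  intro hpi
  have := Fact.mk hp
  have : Finite G := Finite.of_equiv A c.toEquiv.symm
  set P := crossedComap c.toEquiv c.map_mul (primaryPart A p) (smul_mem_primaryPart p) with hP
  have hPp : IsPGroup p P := (isPGroup_primaryPart A p).crossedComap
  have hPn : P.Normal := by
    refine ⟨fun s hs g => ?_⟩
    obtain ⟨a, ha, b, hb, hab⟩ := exists_mem_primaryPart_mul_eq hp (c.toEquiv g)
    obtain ⟨a, rfl⟩ := c.toEquiv.surjective a
    obtain ⟨β, rfl⟩ := c.toEquiv.surjective b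
    have hg : g = a * β := c.toEquiv.injective (by rw [c.map_mul, htriv a _ hb, hab])
    obtain ⟨s', hs'⟩ := c.toEquiv.surjective (β • c.toEquiv s)
    have h1 : β * s = s' * β :=
      c.toEquiv.injective (by rw [c.map_mul, c.map_mul, htriv s' _ hb, hs', mul_comm])
    have hs'P : s' ∈ P := by
      rw [hP, mem_crossedComap, hs']
      exact smul_mem_primaryPart p β _ hs
    have haP : a ∈ P := ha
    have : g * s * g⁻¹ = a * s' * a⁻¹ := by
      rw [hg, mul_assoc a, h1]
      group
    rw [this]
    exact mul_mem (mul_mem haP hs'P) (inv_mem haP)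
  let f : X → primaryPart A p := fun x => ⟨_, mem_primaryPart.2 ⟨c.gen x, rfl⟩⟩
  have hf : Function.Injective f := fun x y h => hpi (congrArg Subtype.val h)
  have hPcard : Nat.card P = Nat.card (primaryPart A p) := card_crossedComap
  have hX : 1 < Nat.card X := Finite.one_lt_card
  have hPnt : Nontrivial P := by
    rw [← Finite.one_lt_card_iff_nontrivial, hPcard]
    exact hX.trans_le (Nat.card_le_card_of_injective f hf)
  have hZnt := hPp.center_nontrivial
  let Z : Subgroup G := (Subgroup.center P).map P.subtype
  have hZn : Z.Normal := inferInstance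
  have hZ : Z ≠ ⊥ := fun h => (Subgroup.nontrivial_iff_ne_bot _).1 hZnt
    ((Subgroup.map_eq_bot_iff_of_injective _ P.subtype_injective).1 h)
  have hZt : MulAction.IsPretransitive Z X :=
    MulAction.IsPreprimitive.isPretransitive_of_ne_bot Z hZ
  obtain ⟨x₀⟩ : Nonempty X := inferInstance
  have hfree : Function.Injective fun s : P => (s : G) • x₀ := by
    intro s s' hss
    refine Subtype.ext (FaithfulSMul.eq_of_smul_eq_smul (α := X) fun x => ?_)
    obtain ⟨⟨_, z, hz, rfl⟩, rfl⟩ := MulAction.exists_smul_eq Z x₀ x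
    have hcomm : ∀ t : P, (t : G) * z = z * t := fun t =>
      congrArg Subtype.val (Subgroup.mem_center_iff.1 hz t)
    change (s : G) • (z : G) • x₀ = (s' : G) • (z : G) • x₀
    rw [smul_smul, smul_smul, hcomm, hcomm, mul_smul, mul_smul]
    exact congrArg _ hss
  have hle : Nat.card (primaryPart A p) ≤ Nat.card X :=
    hPcard ▸ Nat.card_le_card_of_injective _ hfree
  obtain ⟨x, hx⟩ := (hf.bijective_of_nat_card_le hle).2 1
  have hx1 : c.gen x ^ (ordCompl[p] (Nat.card A)) = 1 := congrArg Subtype.val hx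
  obtain ⟨y, hy⟩ := exists_ne x
  obtain ⟨g, rfl⟩ := MulAction.exists_smul_eq G x y
  refine hy (hpi ?_)
  change c.gen (g • x) ^ (ordCompl[p] (Nat.card A)) = c.gen x ^ (ordCompl[p] (Nat.card A))
  rw [c.gen_smul, ← smul_pow', hx1, smul_one]

include c in
theorem card_prime (hX : 1 < Nat.card X) : (Nat.card X).Prime := by
  have : Nontrivial X := Finite.one_lt_card_iff_nontrivial.1 hX
  have : Finite G := Finite.of_equiv A c.toEquiv.symm
  by_cases hinj : ∃ p : ℕ, p.Prime ∧
    Function.Injective fun x => c.gen x ^ (ordCompl[p] (Nat.card A))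
  · obtain ⟨p, hp, hpi⟩ := hinj
    refine absurd hpi (c.not_injective_pow hp fun g b hb => ?_)
    rw [← div_eq_one]
    refine eq_one_of_forall_pow_ordCompl_eq_one fun q hq => ?_
    rw [div_pow, ← smul_pow', div_eq_one]
    by_cases hpq : p = q
    · rw [← hpq, hb, smul_one]
    · exact c.smul_pow_eq ((c.injective_pow_or _).resolve_left fun hqi =>
        hpq (c.eq_of_injective_pow hp hq hpi hqi)) g b
  · push Not at hinj
    have hconst : ∀ x y, c.gen x = c.gen y := by
      intro x y
      rw [← div_eq_one]
      refine eq_one_of_forall_pow_ordCompl_eq_one fun q hq => ?_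
      rw [div_pow, div_eq_one]
      exact (c.injective_pow_or _).resolve_left (hinj q hq) x y
    have htriv : ∀ (g : G) (a : A), g • a = a := fun g a => by
      simpa using c.smul_pow_eq (m := 1) (fun x y => by rw [hconst x y]) g a
    refine MulAction.IsPreprimitive.card_prime_of_comm (G := G) hX fun g h => ?_
    refine c.toEquiv.injective ?_
    rw [c.map_mul, c.map_mul, htriv, htriv, mul_comm]

end PrimitiveCrossedHom

section CycleSet

variable {G X : Type*} [Group G] [Finite G] [MulAction G X] {s : X → G}

omit [MulAction G X] in
theorem forall_of_closure_range_eq_top (hgen : Subgroup.closure (Set.range s) = ⊤) {P : G → Prop}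
    {g₀ : G} (h₀ : P g₀) (h : ∀ g y, P g → P (g * s y)) (g : G) : P g := by
  have key : ∀ u : G, P (g₀ * u) := by
    intro u
    have hu : u ∈ Submonoid.closure (Set.range s) := by
      rw [← Subgroup.closure_toSubmonoid_of_finite, hgen]
      trivial
    induction hu using Submonoid.closure_induction_right with
    | one => rwa [mul_one]
    | mul_right x _ y hy ih =>
      obtain ⟨y, rfl⟩ := hy
      rw [← mul_assoc]
      exact h _ _ ih
  simpa using key (g₀⁻¹ * g)

/-- The translation `g ↦ g * s (g⁻¹ • x)` attached to `x`. -/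
def cycleTranslation (s : X → G) (x : X) (g : G) : G := g * s (g⁻¹ • x)

omit [Finite G] in
theorem cycleTranslation_comm (hs : ∀ x y, s x * s ((s x)⁻¹ • y) = s y * s ((s y)⁻¹ • x))
    (x y : X) (g : G) :
    cycleTranslation s x (cycleTranslation s y g) =
      cycleTranslation s y (cycleTranslation s x g) := by
  simp only [cycleTranslation, mul_inv_rev, mul_smul, mul_assoc, hs (g⁻¹ • y)]

omit [Finite G] in
theorem mul_eq_cycleTranslation (g : G) (y : X) : g * s y = cycleTranslation s (g • y) g := by
  rw [cycleTranslation, inv_smul_smul]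

omit [Finite G] in
theorem mul_cycleTranslation (g u : G) (x : X) :
    g * cycleTranslation s x u = cycleTranslation s (g • x) (g * u) := by
  rw [cycleTranslation, cycleTranslation, mul_inv_rev, mul_smul, inv_smul_smul, mul_assoc]

theorem bijective_cycleTranslation
    (hs : ∀ x y, s x * s ((s x)⁻¹ • y) = s y * s ((s y)⁻¹ • x))
    (hgen : Subgroup.closure (Set.range s) = ⊤) (x : X) :
    Function.Bijective (cycleTranslation s x) := by
  refine Finite.surjective_iff_bijective.1 fun g => ?_
  refine forall_of_closure_range_eq_top (P := fun g => ∃ u, cycleTranslation s x u = g) hgen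
    ⟨1, rfl⟩ ?_ g
  rintro _ y ⟨u, rfl⟩
  rw [mul_eq_cycleTranslation, cycleTranslation_comm hs]
  exact ⟨_, rfl⟩

/-- A finite primitive group generated by the values of a map `s` satisfying the cycle identity
has prime degree. -/
theorem card_prime_of_cycle [FaithfulSMul G X] [MulAction.IsPreprimitive G X] [Finite X]
    (hs : ∀ x y, s x * s ((s x)⁻¹ • y) = s y * s ((s y)⁻¹ • x))
    (hgen : Subgroup.closure (Set.range s) = ⊤) (hX : 1 < Nat.card X) : (Nat.card X).Prime := by
  let T : X → Equiv.Perm G := fun x => Equiv.ofBijective _ (bijective_cycleTranslation hs hgen x)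
  let A : Subgroup (Equiv.Perm G) := Subgroup.closure (Set.range T)
  have : IsMulCommutative A := Subgroup.isMulCommutative_closure <| by
    rintro _ ⟨x, rfl⟩ _ ⟨y, rfl⟩
    exact Equiv.ext (cycleTranslation_comm hs x y)
  let : CommGroup A := { A.toGroup with mul_comm := mul_comm' }
  have hconj : ∀ g x, Equiv.mulLeft g * T x * (Equiv.mulLeft g)⁻¹ = T (g • x) := by
    intro g x
    ext u
    change g * cycleTranslation s x (g⁻¹ * u) = cycleTranslation s (g • x) u
    rw [mul_cycleTranslation, mul_inv_cancel_left]
  have hA : ∀ g, ∀ a ∈ A, Equiv.mulLeft g * a * (Equiv.mulLeft g)⁻¹ ∈ A := by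
    intro g a ha
    induction ha using Subgroup.closure_induction with
    | mem a ha =>
      obtain ⟨x, rfl⟩ := ha
      rw [hconj]
      exact Subgroup.subset_closure ⟨_, rfl⟩
    | one => rw [mul_one, mul_inv_cancel]; exact one_mem A
    | mul a b _ _ iha ihb => rw [← conj_mul]; exact mul_mem iha ihb
    | inv a _ iha => rw [← conj_inv]; exact inv_mem iha
  let : MulDistribMulAction G A :=
    { smul := fun g a => ⟨_, hA g a a.2⟩
      one_smul := fun a => Subtype.ext (Equiv.ext fun u => by
        change 1 * (a : Equiv.Perm G) (1⁻¹ * u) = (a : Equiv.Perm G) u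
        rw [one_mul, inv_one, one_mul])
      mul_smul := fun g h a => Subtype.ext (Equiv.ext fun u => by
        change g * h * (a : Equiv.Perm G) ((g * h)⁻¹ * u) =
          g * (h * (a : Equiv.Perm G) (h⁻¹ * (g⁻¹ * u)))
        rw [mul_inv_rev, mul_assoc, mul_assoc])
      smul_one := fun g => Subtype.ext (Equiv.ext fun u => by
        change g * (g⁻¹ * u) = u
        rw [mul_inv_cancel_left])
      smul_mul := fun g a b => Subtype.ext (Equiv.ext fun u => by
        change g * (a : Equiv.Perm G) ((b : Equiv.Perm G) (g⁻¹ * u)) =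
          g * (a : Equiv.Perm G) (g⁻¹ * (g * (b : Equiv.Perm G) (g⁻¹ * u)))
        rw [inv_mul_cancel_left]) }
  have hcomm : ∀ (a b : A) u, (a : Equiv.Perm G) ((b : Equiv.Perm G) u) =
      (b : Equiv.Perm G) ((a : Equiv.Perm G) u) := fun a b u =>
    Equiv.congr_fun (congrArg Subtype.val (mul_comm a b)) u
  have hsurj : Function.Surjective fun a : A => (a : Equiv.Perm G) 1 := by
    intro g
    refine forall_of_closure_range_eq_top (P := fun g => ∃ a : A, (a : Equiv.Perm G) 1 = g) hgen
      ⟨1, rfl⟩ ?_ g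
    rintro _ y ⟨a, rfl⟩
    rw [mul_eq_cycleTranslation]
    exact ⟨⟨T _, Subgroup.subset_closure ⟨_, rfl⟩⟩ * a, rfl⟩
  have hinj : Function.Injective fun a : A => (a : Equiv.Perm G) 1 := by
    intro a b hab
    refine Subtype.ext (Equiv.ext fun u => ?_)
    obtain ⟨m, rfl⟩ := hsurj u
    change (a : Equiv.Perm G) ((m : Equiv.Perm G) 1) = (b : Equiv.Perm G) ((m : Equiv.Perm G) 1)
    rw [hcomm a, hcomm b]
    exact congrArg _ hab
  let π : A ≃ G := Equiv.ofBijective _ ⟨hinj, hsurj⟩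
  let c : PrimitiveCrossedHom G A X :=
    { toEquiv := π.symm
      map_mul := fun g h => by
        rw [Equiv.symm_apply_eq, mul_comm]
        change g * h = g * (π.symm h : Equiv.Perm G) (g⁻¹ * π (π.symm g))
        rw [Equiv.apply_symm_apply, inv_mul_cancel]
        exact congrArg _ (π.apply_symm_apply h).symm
      gen := fun x => ⟨T x, Subgroup.subset_closure ⟨x, rfl⟩⟩
      gen_smul := fun g x => Subtype.ext (hconj g x).symm
      closure_gen := by
        rw [← top_le_iff, ← Subgroup.closure_closure_coe_preimage (k := Set.range T)]
        refine Subgroup.closure_mono ?_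
        rintro ⟨_, _⟩ ⟨x, rfl⟩
        exact ⟨x, rfl⟩ }
  exact c.card_prime hX

end CycleSet

theorem IsYBSolution.sigmaPerm_mul {X : Type*} {r : X × X → X × X} (h : IsYBSolution r) (x y : X) :
    sigmaPerm r h x * sigmaPerm r h ((sigmaPerm r h x)⁻¹ y) =
      sigmaPerm r h y * sigmaPerm r h ((sigmaPerm r h y)⁻¹ x) := by
  obtain ⟨y, rfl⟩ := (sigmaPerm r h x).surjective y
  rw [show (sigmaPerm r h x)⁻¹ (sigmaPerm r h x y) = y from Equiv.symm_apply_apply _ _]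
  have hγ : (sigmaPerm r h (sigmaPerm r h x y))⁻¹ x = (r (x, y)).2 := by
    rw [Equiv.Perm.inv_eq_iff_eq]
    exact (congrArg Prod.fst (h.1 (x, y))).symm
  rw [hγ]
  ext z
  exact (congrArg Prod.fst (congrFun h.2.2.2 (x, y, z))).symm

/-- a finite primitive solution `(X,r)` of the YBE with `|X| > 1`
has `|X|` a prime number. -/
theorem primitive_solution_card_prime {X : Type*} [Fintype X]
    (r : X × X → X × X) (h : IsYBSolution r)
    (hprim : IsPrimitiveSolution r h) (hX : 1 < Fintype.card X) :
    (Fintype.card X).Prime := by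
  have : MulAction.IsPretransitive (permGroup r h) X := hprim.1
  have : MulAction.IsPreprimitive (permGroup r h) X := ⟨fun {B} hB => hprim.2 B hB⟩
  rw [← Nat.card_eq_fintype_card] at hX ⊢
  refine card_prime_of_cycle (G := permGroup r h)
    (s := fun x => ⟨sigmaPerm r h x, Subgroup.subset_closure ⟨x, rfl⟩⟩)
    (fun x y => Subtype.ext (h.sigmaPerm_mul x y)) ?_ hX
  refine top_le_iff.1 ((Subgroup.closure_closure_coe_preimage
    (k := Set.range (sigmaPerm r h))).ge.trans (Subgroup.closure_mono ?_))
  rintro ⟨_, _⟩ ⟨x, rfl⟩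
  exact ⟨x, rfl⟩
end
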